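/- arXiv:2210.07948 — 14 statements merged into one kernel-verified Lean document; each statement's English description precedes it below -/
import Mathlib

section
/- For every b ∈ K, the line {b + t·u : t ∈ ℝ} through b in the direction u (i.e., the line through b perpendicular to the hyperplane Π = {x ∈ ℝⁿ : x₁ + ⋯ + xₙ = 1}) meets F in exactly one point, namely Φ(b) := b + (1 − maxᵢ bᵢ)·u; that is, {b + t·u : t ∈ ℝ} ∩ F = {b + (1 − maxᵢ bᵢ)·u}. -/
noncomputable section

/-- The all-ones vector `u = (1,…,1)` in `ℝⁿ`. -/
def uvec (n : ℕ) : Fin n → ℝ := fun _ => 1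

/-- The cube `H = [0,1]ⁿ`. -/
def Hset (n : ℕ) : Set (Fin n → ℝ) := {x | ∀ i, 0 ≤ x i ∧ x i ≤ 1}

/-- `F = {x ∈ H : xᵢ = 1 for some i}`. -/
def Fset (n : ℕ) : Set (Fin n → ℝ) := {x ∈ Hset n | ∃ i, x i = 1}

/-- `K = {x ∈ H : x₁ + ⋯ + xₙ = 1}`. -/
def Kset (n : ℕ) : Set (Fin n → ℝ) := {x ∈ Hset n | ∑ i, x i = 1}

/-- For every `b ∈ K`, the line through `b` in direction `u` meets `F` exactly in the point
`Φ(b) = b + (1 − maxᵢ bᵢ)·u`. -/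
theorem stmt0 (n : ℕ) (hn : 2 ≤ n) (b : Fin n → ℝ) (hb : b ∈ Kset n) :
    {x : Fin n → ℝ | ∃ t : ℝ, x = b + t • uvec n} ∩ Fset n
      = {b + (1 - ⨆ i, b i) • uvec n} := by
  have : Nonempty (Fin n) := ⟨⟨0, by omega⟩⟩
  have hle : ∀ i, b i ≤ ⨆ i, b i := fun i => le_ciSup (Set.finite_range b).bddAbove i
  obtain ⟨k, hk⟩ := exists_eq_ciSup_of_finite (f := b)
  ext x
  simp only [Set.mem_inter_iff, Set.mem_ofPred_eq, Set.mem_singleton_iff]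
  constructor
  · rintro ⟨⟨t, rfl⟩, hH, j, hj⟩
    have hk1 := (hH k).2
    have hj1 := hle j
    simp only [uvec, Pi.add_apply, Pi.smul_apply, smul_eq_mul, mul_one] at hj hk1
    have ht : t = 1 - ⨆ i, b i := by linarith
    rw [ht]
  · rintro rfl
    refine ⟨⟨_, rfl⟩, fun i => ?_, k, ?_⟩
    · have h0 := (hb.1 i).1
      have hk1 := (hb.1 k).2
      have hi := hle i
      simp only [uvec, Pi.add_apply, Pi.smul_apply, smul_eq_mul, mul_one]
      constructor <;> linarith
    · simp only [uvec, Pi.add_apply, Pi.smul_apply, smul_eq_mul, mul_one]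
      linarith
end
end

section
/- The map Φ : K → F defined by Φ(b) = b + (1 − maxᵢ bᵢ)·u is well defined (its values lie in F) and injective, its image is exactly G, and the map a ↦ a + (1/n)(1 − (a₁ + ⋯ + aₙ))·u sends G into K and is a two-sided inverse of Φ viewed as a map K → G. -/
noncomputable section

/-- `G = {a ∈ F : a₁ + ⋯ + aₙ ≤ n·aᵢ + 1 for all i}`. -/
def Gset (n : ℕ) : Set (Fin n → ℝ) := {a ∈ Fset n | ∀ i, ∑ j, a j ≤ n * a i + 1}

/-- The map `Φ(b) = b + (1 − maxᵢ bᵢ)·u`. -/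
def Phi (n : ℕ) (b : Fin n → ℝ) : Fin n → ℝ := b + (1 - ⨆ i, b i) • uvec n

/-- The map `a ↦ a + (1/n)(1 − Σᵢ aᵢ)·u`. -/
def PhiInv (n : ℕ) (a : Fin n → ℝ) : Fin n → ℝ := a + ((1 - ∑ i, a i) / n) • uvec n

theorem iSup_eq_of_forall_le_of_eq {ι α : Type*} [ConditionallyCompleteLattice α] {b : ι → α}
    {m : α} {i : ι}
    (h : ∀ j, b j ≤ m) (hi : b i = m) : ⨆ j, b j = m :=
  IsGreatest.csSup_eq ⟨⟨i, hi⟩, Set.forall_mem_range.mpr h⟩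

theorem phi_apply (n : ℕ) (b : Fin n → ℝ) (i : Fin n) :
    Phi n b i = b i + (1 - ⨆ j, b j) := by
  simp [Phi, uvec]

theorem phiInv_apply (n : ℕ) (a : Fin n → ℝ) (i : Fin n) :
    PhiInv n a i = a i + (1 - ∑ j, a j) / n := by
  simp [PhiInv, uvec]

theorem sum_phi (n : ℕ) (b : Fin n → ℝ) :
    ∑ i, Phi n b i = ∑ i, b i + n * (1 - ⨆ j, b j) := by
  simp [phi_apply, Finset.sum_add_distrib, mul_sub]

theorem sum_phiInv {n : ℕ} (hn : n ≠ 0) (a : Fin n → ℝ) : ∑ i, PhiInv n a i = 1 := by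
  have : (n : ℝ) ≠ 0 := Nat.cast_ne_zero.mpr hn
  simp only [phiInv_apply, Finset.sum_add_distrib, Finset.sum_const, Finset.card_univ,
    Fintype.card_fin, nsmul_eq_mul]
  field_simp
  ring

theorem phi_mem_Gset {n : ℕ} (hn : n ≠ 0) {b : Fin n → ℝ} (hb : b ∈ Kset n) :
    Phi n b ∈ Gset n := by
  obtain ⟨hH, hsum⟩ := hb
  have : NeZero n := ⟨hn⟩
  obtain ⟨i₀, hi₀⟩ := exists_eq_ciSup_of_finite (f := b)
  have hle : ∀ i, b i ≤ ⨆ j, b j := le_ciSup (Set.finite_range b).bddAbove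
  refine ⟨⟨fun i => ?_, i₀, ?_⟩, fun i => ?_⟩
  · rw [phi_apply]
    constructor <;> linarith [hH i, hH i₀, hle i]
  · rw [phi_apply]
    linarith
  · rw [sum_phi, phi_apply, hsum]
    nlinarith [mul_nonneg (Nat.cast_nonneg (α := ℝ) n) (hH i).1]

theorem phiInv_mem_Kset {n : ℕ} (hn : n ≠ 0) {a : Fin n → ℝ} (ha : a ∈ Gset n) :
    PhiInv n a ∈ Kset n := by
  have hnonneg : ∀ i, 0 ≤ PhiInv n a i := fun i => by
    have hpos : (0 : ℝ) < n := Nat.cast_pos.mpr (Nat.pos_of_ne_zero hn)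
    have heq : PhiInv n a i = (n * a i + 1 - ∑ j, a j) / n := by
      rw [phiInv_apply]
      field_simp
      ring
    rw [heq]
    exact div_nonneg (sub_nonneg.mpr (ha.2 i)) hpos.le
  refine ⟨fun i => ⟨hnonneg i, ?_⟩, sum_phiInv hn a⟩
  rw [← sum_phiInv hn a]
  exact Finset.single_le_sum (fun j _ => hnonneg j) (Finset.mem_univ i)

theorem phiInv_phi {n : ℕ} (hn : n ≠ 0) {b : Fin n → ℝ} (hb : b ∈ Kset n) :
    PhiInv n (Phi n b) = b := by
  have : (n : ℝ) ≠ 0 := Nat.cast_ne_zero.mpr hn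
  ext i
  rw [phiInv_apply, sum_phi, phi_apply, hb.2]
  field_simp
  ring

theorem phi_phiInv {n : ℕ} {a : Fin n → ℝ} (ha : a ∈ Fset n) : Phi n (PhiInv n a) = a := by
  obtain ⟨hH, i₀, hi₀⟩ := ha
  have hmax : ⨆ j, PhiInv n a j = 1 + (1 - ∑ j, a j) / n := by
    refine iSup_eq_of_forall_le_of_eq (i := i₀) (fun j => ?_) ?_
    · rw [phiInv_apply]
      linarith [(hH j).2]
    · rw [phiInv_apply, hi₀]
  ext i
  rw [phi_apply, hmax, phiInv_apply]
  ring

/-- `Φ : K → F`, `Φ(b) = b + (1 − maxᵢ bᵢ)·u`, is well defined and injective, its image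
is exactly `G`, and `a ↦ a + (1/n)(1 − Σᵢ aᵢ)·u` maps `G` into `K` and is a two-sided
inverse of `Φ : K → G`. -/
theorem stmt1 (n : ℕ) (hn : 2 ≤ n) :
    (∀ b ∈ Kset n, Phi n b ∈ Fset n) ∧
    (∀ b ∈ Kset n, ∀ b' ∈ Kset n, Phi n b = Phi n b' → b = b') ∧
    Phi n '' Kset n = Gset n ∧
    (∀ a ∈ Gset n, PhiInv n a ∈ Kset n) ∧
    (∀ b ∈ Kset n, PhiInv n (Phi n b) = b) ∧
    (∀ a ∈ Gset n, Phi n (PhiInv n a) = a) := by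
  have hn0 : n ≠ 0 := by omega
  refine ⟨fun b hb => (phi_mem_Gset hn0 hb).1, fun b hb b' hb' h => ?_, ?_,
    fun a ha => phiInv_mem_Kset hn0 ha, fun b hb => phiInv_phi hn0 hb,
    fun a ha => phi_phiInv ha.1⟩
  · rw [← phiInv_phi hn0 hb, h, phiInv_phi hn0 hb']
  · refine Set.Subset.antisymm ?_ fun a ha =>
      ⟨PhiInv n a, phiInv_mem_Kset hn0 ha, phi_phiInv ha.1⟩
    rintro _ ⟨b, hb, rfl⟩
    exact phi_mem_Gset hn0 hb
end
end

section
/- The map Φ₁ : F → G defined coordinatewise by Φ₁(c₁,…,cₙ)ᵢ = (cᵢ − 1)/(c₁ + ⋯ + cₙ) + 1 is a bijection from F onto G, and its inverse Φ₁⁻¹ : G → F is given coordinatewise by Φ₁⁻¹(a₁,…,aₙ)ᵢ = (n·aᵢ − n)/(n + 1 − (a₁ + ⋯ + aₙ)) + 1. -/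
noncomputable section

/-- `Φ₁(c)ᵢ = (cᵢ − 1)/(c₁ + ⋯ + cₙ) + 1`. -/
def Phi1 (n : ℕ) (c : Fin n → ℝ) : Fin n → ℝ := fun i => (c i - 1) / (∑ j, c j) + 1

/-- `Φ₁⁻¹(a)ᵢ = (n·aᵢ − n)/(n + 1 − (a₁ + ⋯ + aₙ)) + 1`. -/
def Phi1Inv (n : ℕ) (a : Fin n → ℝ) : Fin n → ℝ :=
  fun i => ((n : ℝ) * a i - n) / ((n : ℝ) + 1 - ∑ j, a j) + 1

/-- The coordinate sum of a point of `F` is at least `1`. -/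
lemma one_le_sum_of_mem_Fset {n : ℕ} {c : Fin n → ℝ} (hc : c ∈ Fset n) : 1 ≤ ∑ j, c j := by
  obtain ⟨hH, i, hi⟩ := hc
  rw [← hi]
  exact Finset.single_le_sum (fun j _ => (hH j).1) (Finset.mem_univ i)

/-- The coordinate sum of a point of `H` is at most `n`. -/
lemma sum_le_of_mem_Hset {n : ℕ} {c : Fin n → ℝ} (hc : c ∈ Hset n) : ∑ j, c j ≤ n := by
  simpa using Finset.sum_le_sum (fun j (_ : j ∈ Finset.univ) => (hc j).2)

lemma sum_Phi1 {n : ℕ} {c : Fin n → ℝ} (hc : ∑ j, c j ≠ 0) :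
    ∑ i, Phi1 n c i = (n : ℝ) + 1 - n / ∑ j, c j := by
  simp only [Phi1, Finset.sum_add_distrib, ← Finset.sum_div, Finset.sum_sub_distrib,
    Finset.sum_const, Finset.card_univ, Fintype.card_fin, nsmul_eq_mul, mul_one]
  field_simp
  ring

lemma sum_Phi1Inv {n : ℕ} {a : Fin n → ℝ} (ha : (n : ℝ) + 1 - ∑ j, a j ≠ 0) :
    ∑ i, Phi1Inv n a i = n / ((n : ℝ) + 1 - ∑ j, a j) := by
  simp only [Phi1Inv, Finset.sum_add_distrib, ← Finset.sum_div, Finset.sum_sub_distrib,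
    ← Finset.mul_sum, Finset.sum_const, Finset.card_univ, Fintype.card_fin, nsmul_eq_mul, mul_one]
  field_simp
  ring

lemma Phi1_mem_Gset {n : ℕ} {c : Fin n → ℝ} (hc : c ∈ Fset n) : Phi1 n c ∈ Gset n := by
  have hs := one_le_sum_of_mem_Fset hc
  have hs0 : 0 < ∑ j, c j := by linarith
  refine ⟨⟨fun i => ⟨?_, ?_⟩, ?_⟩, fun i => ?_⟩
  · have h : -1 ≤ (c i - 1) / ∑ j, c j := by
      rw [le_div_iff₀ hs0]
      linarith [(hc.1 i).1]
    simp only [Phi1]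
    linarith
  · have h : (c i - 1) / ∑ j, c j ≤ 0 :=
      div_nonpos_of_nonpos_of_nonneg (by linarith [(hc.1 i).2]) hs0.le
    simp only [Phi1]
    linarith
  · obtain ⟨i, hi⟩ := hc.2
    exact ⟨i, by simp [Phi1, hi]⟩
  · have h : 0 ≤ n * c i / ∑ j, c j :=
      div_nonneg (mul_nonneg n.cast_nonneg (hc.1 i).1) hs0.le
    have e : n * Phi1 n c i + 1 = n * c i / (∑ j, c j) + ((n : ℝ) + 1 - n / ∑ j, c j) := by
      simp only [Phi1]
      ring
    rw [sum_Phi1 hs0.ne', e]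
    linarith

lemma Phi1Inv_mem_Fset {n : ℕ} {a : Fin n → ℝ} (ha : a ∈ Gset n) : Phi1Inv n a ∈ Fset n := by
  have ht : 0 < (n : ℝ) + 1 - ∑ j, a j := by linarith [sum_le_of_mem_Hset ha.1.1]
  refine ⟨fun i => ⟨?_, ?_⟩, ?_⟩
  · have h : -1 ≤ ((n : ℝ) * a i - n) / ((n : ℝ) + 1 - ∑ j, a j) := by
      rw [le_div_iff₀ ht]
      linarith [ha.2 i]
    simp only [Phi1Inv]
    linarith
  · have h : ((n : ℝ) * a i - n) / ((n : ℝ) + 1 - ∑ j, a j) ≤ 0 :=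
      div_nonpos_of_nonpos_of_nonneg
        (by linarith [mul_le_mul_of_nonneg_left (ha.1.1 i).2 (n.cast_nonneg (α := ℝ))]) ht.le
    simp only [Phi1Inv]
    linarith
  · obtain ⟨i, hi⟩ := ha.1.2
    exact ⟨i, by simp [Phi1Inv, hi]⟩

lemma Phi1Inv_Phi1 {n : ℕ} (hn : n ≠ 0) {c : Fin n → ℝ} (hc : ∑ j, c j ≠ 0) :
    Phi1Inv n (Phi1 n c) = c := by
  have hn' : (n : ℝ) ≠ 0 := Nat.cast_ne_zero.mpr hn
  funext i
  rw [Phi1Inv, sum_Phi1 hc, sub_sub_cancel, Phi1]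
  field_simp
  ring

lemma Phi1_Phi1Inv {n : ℕ} (hn : n ≠ 0) {a : Fin n → ℝ}
    (ha : (n : ℝ) + 1 - ∑ j, a j ≠ 0) : Phi1 n (Phi1Inv n a) = a := by
  have hn' : (n : ℝ) ≠ 0 := Nat.cast_ne_zero.mpr hn
  funext i
  rw [Phi1, sum_Phi1Inv ha, Phi1Inv]
  field_simp
  ring

/-- `Φ₁ : F → G` is a bijection from `F` onto `G`, with inverse `Φ₁⁻¹ : G → F` given
coordinatewise by `aᵢ ↦ (n·aᵢ − n)/(n + 1 − Σⱼ aⱼ) + 1`. -/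
theorem stmt3 (n : ℕ) (hn : 2 ≤ n) :
    (∀ c ∈ Fset n, Phi1 n c ∈ Gset n) ∧
    Set.BijOn (Phi1 n) (Fset n) (Gset n) ∧
    (∀ a ∈ Gset n, Phi1Inv n a ∈ Fset n) ∧
    (∀ c ∈ Fset n, Phi1Inv n (Phi1 n c) = c) ∧
    (∀ a ∈ Gset n, Phi1 n (Phi1Inv n a) = a) := by
  have left_inv : ∀ c ∈ Fset n, Phi1Inv n (Phi1 n c) = c := fun c hc =>
    Phi1Inv_Phi1 (by lia) (by linarith [one_le_sum_of_mem_Fset hc] : 0 < ∑ j, c j).ne'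
  have right_inv : ∀ a ∈ Gset n, Phi1 n (Phi1Inv n a) = a := fun a ha =>
    Phi1_Phi1Inv (by lia)
      (by linarith [sum_le_of_mem_Hset ha.1.1] : 0 < (n : ℝ) + 1 - ∑ j, a j).ne'
  have mapsTo : Set.MapsTo (Phi1 n) (Fset n) (Gset n) := fun _ hc => Phi1_mem_Gset hc
  have mapsTo_inv : Set.MapsTo (Phi1Inv n) (Gset n) (Fset n) := fun _ ha => Phi1Inv_mem_Fset ha
  exact ⟨mapsTo, Set.InvOn.bijOn ⟨left_inv, right_inv⟩ mapsTo mapsTo_inv, mapsTo_inv,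
    left_inv, right_inv⟩
end
end

section
/- For every permutation σ of {1,…,n}, the map Φ_{2,σ} : G_σ → F_σ, sending a to the vector c determined by c_{σ(1)} = a_{σ(1)}, c_{σ(2)} = a_{σ(2)}, and c_{σ(k)} = (k−1)·a_{σ(k)} − (a_{σ(2)} + ⋯ + a_{σ(k−1)}) for 3 ≤ k ≤ n, is well defined (its values lie in F_σ) and bijective; its inverse Φ_{2,σ}⁻¹ : F_σ → G_σ sends c to the vector a determined by a_{σ(1)} = c_{σ(1)}, a_{σ(2)} = c_{σ(2)}, and a_{σ(k)} = Σ_{m=2}^{k−1} c_{σ(m)}/((m−1)·m) + c_{σ(k)}/(k−1) for 3 ≤ k ≤ n. -/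
noncomputable section

/-- `F_σ = {c ∈ F : 1 = c_{σ(1)} ≥ c_{σ(2)} ≥ ⋯ ≥ c_{σ(n)}}`.
Here positions in `Fin n` are 0-indexed: position `k : Fin n` corresponds to `k+1`. -/
def Fsig (n : ℕ) (σ : Equiv.Perm (Fin n)) : Set (Fin n → ℝ) :=
  {c ∈ Fset n | (∀ k : Fin n, k.val = 0 → c (σ k) = 1) ∧
    ∀ k l : Fin n, k ≤ l → c (σ l) ≤ c (σ k)}

/-- `G_σ = {a ∈ G : 1 = a_{σ(1)} ≥ a_{σ(2)} ≥ ⋯ ≥ a_{σ(n)}}`. -/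
def Gsig (n : ℕ) (σ : Equiv.Perm (Fin n)) : Set (Fin n → ℝ) :=
  {a ∈ Gset n | (∀ k : Fin n, k.val = 0 → a (σ k) = 1) ∧
    ∀ k l : Fin n, k ≤ l → a (σ l) ≤ a (σ k)}

/-- `Φ_{2,σ}` sends `a` to the vector `c` with `c_{σ(1)} = a_{σ(1)}`, `c_{σ(2)} = a_{σ(2)}`
and `c_{σ(k)} = (k−1)·a_{σ(k)} − (a_{σ(2)} + ⋯ + a_{σ(k−1)})` for `3 ≤ k ≤ n`
(the latter formula, in 0-indexed form, also covers `k = 2`). -/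
def Phi2 (n : ℕ) (σ : Equiv.Perm (Fin n)) (a : Fin n → ℝ) : Fin n → ℝ := fun i =>
  if (σ.symm i).val = 0 then a i
  else ((σ.symm i).val : ℝ) * a i -
    ∑ m ∈ Finset.univ.filter (fun m : Fin n => 1 ≤ m.val ∧ m.val < (σ.symm i).val), a (σ m)

/-- `Φ_{2,σ}⁻¹` sends `c` to the vector `a` with `a_{σ(1)} = c_{σ(1)}`, `a_{σ(2)} = c_{σ(2)}`
and `a_{σ(k)} = Σ_{m=2}^{k−1} c_{σ(m)}/((m−1)m) + c_{σ(k)}/(k−1)` for `3 ≤ k ≤ n`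
(the latter formula, in 0-indexed form, also covers `k = 2`). -/
def Phi2Inv (n : ℕ) (σ : Equiv.Perm (Fin n)) (c : Fin n → ℝ) : Fin n → ℝ := fun i =>
  if (σ.symm i).val = 0 then c i
  else (∑ m ∈ Finset.univ.filter (fun m : Fin n => 1 ≤ m.val ∧ m.val < (σ.symm i).val),
      c (σ m) / ((m.val : ℝ) * ((m.val : ℝ) + 1))) + c i / ((σ.symm i).val : ℝ)

/-- The coordinates of `a` listed in the order given by `σ`, extended by `0` to a sequence. -/
def sortedSeq {n : ℕ} (σ : Equiv.Perm (Fin n)) (a : Fin n → ℝ) (k : ℕ) : ℝ :=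
  if h : k < n then a (σ ⟨k, h⟩) else 0

/-- `Φ₂` on sequences, at positive positions. -/
def seqPhi (b : ℕ → ℝ) (k : ℕ) : ℝ := k * b k - ∑ m ∈ Finset.Ico 1 k, b m

/-- `Φ₂⁻¹` on sequences, at positive positions. -/
def seqPhiInv (d : ℕ → ℝ) (k : ℕ) : ℝ :=
  ∑ m ∈ Finset.Ico 1 k, d m / ((m : ℝ) * ((m : ℝ) + 1)) + d k / k

lemma seqPhi_one (b : ℕ → ℝ) : seqPhi b 1 = b 1 := by simp [seqPhi]

lemma seqPhiInv_one (d : ℕ → ℝ) : seqPhiInv d 1 = d 1 := by simp [seqPhiInv]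

lemma seqPhi_succ (b : ℕ → ℝ) {k : ℕ} (hk : 1 ≤ k) :
    seqPhi b (k + 1) = seqPhi b k + (k + 1) * (b (k + 1) - b k) := by
  simp only [seqPhi, Finset.sum_Ico_succ_top hk]
  push_cast
  ring

lemma seqPhiInv_succ (d : ℕ → ℝ) {k : ℕ} (hk : 1 ≤ k) :
    seqPhiInv d (k + 1) = seqPhiInv d k + (d (k + 1) - d k) / (k + 1) := by
  have hk' : (k : ℝ) ≠ 0 := by positivity
  simp only [seqPhiInv, Finset.sum_Ico_succ_top hk]
  push_cast
  field_simp
  ring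

lemma seqPhiInv_eq_of_eq_seqPhi {b d : ℕ → ℝ} {n : ℕ}
    (h : ∀ k, 1 ≤ k → k < n → d k = seqPhi b k) {k : ℕ} (hk : 1 ≤ k) (hkn : k < n) :
    seqPhiInv d k = b k := by
  induction k, hk using Nat.le_induction with
  | base => rw [seqPhiInv_one, h 1 le_rfl hkn, seqPhi_one]
  | succ k hk ih =>
    have hk' : (k : ℝ) + 1 ≠ 0 := by positivity
    rw [seqPhiInv_succ d hk, ih (by omega), h k hk (by omega), h (k + 1) (by omega) hkn,
      seqPhi_succ b hk]
    field_simp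
    ring

lemma seqPhi_eq_of_eq_seqPhiInv {b d : ℕ → ℝ} {n : ℕ}
    (h : ∀ k, 1 ≤ k → k < n → b k = seqPhiInv d k) {k : ℕ} (hk : 1 ≤ k) (hkn : k < n) :
    seqPhi b k = d k := by
  induction k, hk using Nat.le_induction with
  | base => rw [seqPhi_one, h 1 le_rfl hkn, seqPhiInv_one]
  | succ k hk ih =>
    have hk' : (k : ℝ) + 1 ≠ 0 := by positivity
    rw [seqPhi_succ b hk, ih (by omega), h k hk (by omega), h (k + 1) (by omega) hkn,
      seqPhiInv_succ d hk]
    field_simp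
    ring

lemma sum_filter_fin_eq_sum_Ico {n k : ℕ} (hk : k ≤ n) (f : ℕ → ℝ) :
    ∑ m ∈ Finset.univ.filter (fun m : Fin n => 1 ≤ m.val ∧ m.val < k), f m.val =
      ∑ m ∈ Finset.Ico 1 k, f m := by
  rw [Finset.sum_filter,
    Fin.sum_univ_eq_sum_range (fun m => if 1 ≤ m ∧ m < k then f m else 0) n, ← Finset.sum_filter]
  congr 1
  ext m
  simp only [Finset.mem_filter, Finset.mem_range, Finset.mem_Ico]
  omega

section

variable {n : ℕ} (σ : Equiv.Perm (Fin n))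

lemma sortedSeq_val (a : Fin n → ℝ) (k : Fin n) : sortedSeq σ a k.val = a (σ k) := by
  simp [sortedSeq]

lemma sortedSeq_of_lt (a : Fin n → ℝ) {k : ℕ} (hk : k < n) :
    sortedSeq σ a k = a (σ ⟨k, hk⟩) := by
  simp [sortedSeq, hk]

lemma eq_of_sortedSeq_eq {a c : Fin n → ℝ}
    (h : ∀ k, k < n → sortedSeq σ a k = sortedSeq σ c k) : a = c := by
  ext i
  have := h (σ.symm i).val (σ.symm i).isLt
  simpa only [sortedSeq_val, Equiv.apply_symm_apply] using this

lemma sum_eq_sum_sortedSeq (a : Fin n → ℝ) :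
    ∑ j, a j = ∑ k ∈ Finset.range n, sortedSeq σ a k := by
  rw [← Equiv.sum_comp σ, ← Fin.sum_univ_eq_sum_range]
  simp only [sortedSeq_val]

lemma sortedSeq_Phi2_zero (hn : 0 < n) (a : Fin n → ℝ) :
    sortedSeq σ (Phi2 n σ a) 0 = sortedSeq σ a 0 := by
  simp [sortedSeq_of_lt σ _ hn, Phi2]

lemma sortedSeq_Phi2Inv_zero (hn : 0 < n) (c : Fin n → ℝ) :
    sortedSeq σ (Phi2Inv n σ c) 0 = sortedSeq σ c 0 := by
  simp [sortedSeq_of_lt σ _ hn, Phi2Inv]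

lemma sortedSeq_Phi2 (a : Fin n → ℝ) {k : ℕ} (hk : 1 ≤ k) (hkn : k < n) :
    sortedSeq σ (Phi2 n σ a) k = seqPhi (sortedSeq σ a) k := by
  rw [seqPhi, ← sum_filter_fin_eq_sum_Ico hkn.le]
  simp only [sortedSeq_val]
  simp [sortedSeq_of_lt σ _ hkn, Phi2, Nat.one_le_iff_ne_zero.mp hk]

lemma sortedSeq_Phi2Inv (c : Fin n → ℝ) {k : ℕ} (hk : 1 ≤ k) (hkn : k < n) :
    sortedSeq σ (Phi2Inv n σ c) k = seqPhiInv (sortedSeq σ c) k := by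
  rw [seqPhiInv, ← sum_filter_fin_eq_sum_Ico hkn.le
    (fun m => sortedSeq σ c m / ((m : ℝ) * ((m : ℝ) + 1)))]
  simp only [sortedSeq_val]
  simp [sortedSeq_of_lt σ _ hkn, Phi2Inv, Nat.one_le_iff_ne_zero.mp hk]

lemma Phi2Inv_Phi2 (a : Fin n → ℝ) : Phi2Inv n σ (Phi2 n σ a) = a := by
  refine eq_of_sortedSeq_eq σ fun k hkn => ?_
  rcases Nat.eq_zero_or_pos k with rfl | hk
  · rw [sortedSeq_Phi2Inv_zero σ hkn, sortedSeq_Phi2_zero σ hkn]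
  · rw [sortedSeq_Phi2Inv σ _ hk hkn]
    exact seqPhiInv_eq_of_eq_seqPhi (fun k hk hkn => sortedSeq_Phi2 σ a hk hkn) hk hkn

lemma Phi2_Phi2Inv (c : Fin n → ℝ) : Phi2 n σ (Phi2Inv n σ c) = c := by
  refine eq_of_sortedSeq_eq σ fun k hkn => ?_
  rcases Nat.eq_zero_or_pos k with rfl | hk
  · rw [sortedSeq_Phi2_zero σ hkn, sortedSeq_Phi2Inv_zero σ hkn]
  · rw [sortedSeq_Phi2 σ _ hk hkn]
    exact seqPhi_eq_of_eq_seqPhiInv (fun k hk hkn => sortedSeq_Phi2Inv σ c hk hkn) hk hkn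

lemma mem_Fsig_iff (hn : 0 < n) (c : Fin n → ℝ) :
    c ∈ Fsig n σ ↔ sortedSeq σ c 0 = 1 ∧
      (∀ k, k + 1 < n → sortedSeq σ c (k + 1) ≤ sortedSeq σ c k) ∧
      0 ≤ sortedSeq σ c (n - 1) := by
  constructor
  · rintro ⟨⟨hH, -⟩, h0, hanti⟩
    refine ⟨?_, fun k hk => ?_, ?_⟩
    · rw [sortedSeq_of_lt σ _ hn]
      exact h0 _ rfl
    · rw [sortedSeq_of_lt σ _ hk, sortedSeq_of_lt σ _ (Nat.lt_of_succ_lt hk)]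
      exact hanti _ _ (Fin.mk_le_mk.mpr k.le_succ)
    · rw [sortedSeq_of_lt σ _ (Nat.sub_one_lt_of_lt hn)]
      exact (hH _).1
  · rintro ⟨h0, hstep, hlast⟩
    have hanti : ∀ k l, k ≤ l → l < n → sortedSeq σ c l ≤ sortedSeq σ c k := by
      intro k l hkl
      induction l, hkl using Nat.le_induction with
      | base => exact fun _ => le_rfl
      | succ l _ ih => exact fun hl => (hstep l hl).trans (ih (by omega))
    refine ⟨⟨fun i => ?_, σ ⟨0, hn⟩, ?_⟩, fun k hk => ?_, fun k l hkl => ?_⟩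
    · obtain ⟨k, rfl⟩ := σ.surjective i
      rw [← sortedSeq_val σ c]
      exact ⟨hlast.trans (hanti _ _ (by omega) (by omega)),
        (hanti 0 _ (Nat.zero_le _) k.isLt).trans h0.le⟩
    · rw [← sortedSeq_of_lt σ c, h0]
    · rw [← sortedSeq_val σ c, hk, h0]
    · rw [← sortedSeq_val σ c, ← sortedSeq_val σ c]
      exact hanti _ _ hkl l.isLt

lemma sum_range_eq_seqPhi (hn : 2 ≤ n) (b : ℕ → ℝ) :
    ∑ k ∈ Finset.range n, b k = b 0 + n * b (n - 1) - seqPhi b (n - 1) := by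
  obtain ⟨m, rfl⟩ := Nat.exists_eq_add_of_le' hn
  rw [Finset.range_eq_Ico, Finset.sum_eq_sum_Ico_succ_bot (by omega), seqPhi,
    Finset.sum_Ico_succ_top (by omega)]
  simp only [show m + 2 - 1 = m + 1 by omega]
  push_cast
  ring

lemma mem_Gsig_iff (hn : 2 ≤ n) (a : Fin n → ℝ) :
    a ∈ Gsig n σ ↔ a ∈ Fsig n σ ∧ 0 ≤ seqPhi (sortedSeq σ a) (n - 1) := by
  have hlast : n - 1 < n := by omega
  have hsum := (sum_eq_sum_sortedSeq σ a).trans (sum_range_eq_seqPhi hn _)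
  constructor
  · rintro ⟨⟨hF, hG⟩, h0, hanti⟩
    have ha : a ∈ Fsig n σ := ⟨hF, h0, hanti⟩
    refine ⟨ha, ?_⟩
    have := hG (σ ⟨n - 1, hlast⟩)
    rw [← sortedSeq_of_lt σ a, hsum, ((mem_Fsig_iff σ (by omega) a).mp ha).1] at this
    linarith
  · rintro ⟨ha, hnonneg⟩
    refine ⟨⟨ha.1, fun i => ?_⟩, ha.2⟩
    obtain ⟨k, rfl⟩ := σ.surjective i
    have hle : sortedSeq σ a (n - 1) ≤ a (σ k) := by
      rw [sortedSeq_of_lt σ _ hlast]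
      exact ha.2.2 _ _ (Fin.le_def.mpr (by simp only; omega))
    have := mul_le_mul_of_nonneg_left hle n.cast_nonneg
    rw [hsum, ((mem_Fsig_iff σ (by omega) a).mp ha).1]
    linarith

lemma Phi2_mem_Fsig (hn : 2 ≤ n) {a : Fin n → ℝ} (ha : a ∈ Gsig n σ) :
    Phi2 n σ a ∈ Fsig n σ := by
  rw [mem_Gsig_iff σ hn, mem_Fsig_iff σ (by omega)] at ha
  obtain ⟨⟨h0, hstep, -⟩, hnonneg⟩ := ha
  refine (mem_Fsig_iff σ (by omega) _).mpr ⟨?_, fun k hk => ?_, ?_⟩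
  · rw [sortedSeq_Phi2_zero σ (by omega), h0]
  · rw [sortedSeq_Phi2 σ _ (by omega) hk]
    rcases Nat.eq_zero_or_pos k with rfl | hk'
    · rw [sortedSeq_Phi2_zero σ (by omega), seqPhi_one]
      exact hstep 0 hk
    · rw [sortedSeq_Phi2 σ _ hk' (by omega), seqPhi_succ _ hk']
      have := mul_nonpos_of_nonneg_of_nonpos (show (0 : ℝ) ≤ k + 1 by positivity)
        (sub_nonpos.mpr (hstep k hk))
      linarith
  · rwa [sortedSeq_Phi2 σ _ (by omega) (by omega)]

lemma Phi2Inv_mem_Gsig (hn : 2 ≤ n) {c : Fin n → ℝ} (hc : c ∈ Fsig n σ) :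
    Phi2Inv n σ c ∈ Gsig n σ := by
  have hpos : ∀ k, k < n → 0 ≤ sortedSeq σ c k := fun k hk => by
    rw [sortedSeq_of_lt σ _ hk]
    exact (hc.1.1 _).1
  rw [mem_Fsig_iff σ (by omega)] at hc
  obtain ⟨h0, hstep, hlast⟩ := hc
  refine (mem_Gsig_iff σ hn _).mpr ⟨(mem_Fsig_iff σ (by omega) _).mpr ⟨?_, fun k hk => ?_, ?_⟩, ?_⟩
  · rw [sortedSeq_Phi2Inv_zero σ (by omega), h0]
  · rw [sortedSeq_Phi2Inv σ _ (by omega) hk]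
    rcases Nat.eq_zero_or_pos k with rfl | hk'
    · rw [sortedSeq_Phi2Inv_zero σ (by omega), seqPhiInv_one]
      exact hstep 0 hk
    · rw [sortedSeq_Phi2Inv σ _ hk' (by omega), seqPhiInv_succ _ hk']
      have := div_nonpos_of_nonpos_of_nonneg (sub_nonpos.mpr (hstep k hk))
        (show (0 : ℝ) ≤ k + 1 by positivity)
      linarith
  · rw [sortedSeq_Phi2Inv σ _ (by omega) (by omega), seqPhiInv]
    refine add_nonneg (Finset.sum_nonneg fun m hm => ?_) (div_nonneg hlast (Nat.cast_nonneg _))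
    rw [Finset.mem_Ico] at hm
    exact div_nonneg (hpos m (by omega)) (by positivity)
  · rwa [← sortedSeq_Phi2 σ _ (by omega) (by omega), Phi2_Phi2Inv]

end

/-- For every permutation `σ`, `Φ_{2,σ} : G_σ → F_σ` is well defined and bijective,
with two-sided inverse `Φ_{2,σ}⁻¹ : F_σ → G_σ`. -/
theorem stmt4 (n : ℕ) (hn : 2 ≤ n) (σ : Equiv.Perm (Fin n)) :
    (∀ a ∈ Gsig n σ, Phi2 n σ a ∈ Fsig n σ) ∧
    Set.BijOn (Phi2 n σ) (Gsig n σ) (Fsig n σ) ∧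
    (∀ c ∈ Fsig n σ, Phi2Inv n σ c ∈ Gsig n σ) ∧
    (∀ a ∈ Gsig n σ, Phi2Inv n σ (Phi2 n σ a) = a) ∧
    (∀ c ∈ Fsig n σ, Phi2 n σ (Phi2Inv n σ c) = c) := by
  exact ⟨fun _ => Phi2_mem_Fsig σ hn,
    Set.InvOn.bijOn ⟨fun a _ => Phi2Inv_Phi2 σ a, fun c _ => Phi2_Phi2Inv σ c⟩
      (fun _ => Phi2_mem_Fsig σ hn) (fun _ => Phi2Inv_mem_Gsig σ hn),
    fun _ => Phi2Inv_mem_Gsig σ hn, fun a _ => Phi2Inv_Phi2 σ a, fun c _ => Phi2_Phi2Inv σ c⟩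
end
end

section
/- Let σ be a permutation of {1,…,n}, let a ∈ G_σ, and let c = Φ_{2,σ}(a). Then for all indices 1 ≤ i < j ≤ n one has aᵢ = aⱼ if and only if cᵢ = cⱼ. -/
noncomputable section

/-- A sequence whose increments are `k + 1` times those of an antitone sequence `f` decreases at
least as much as `f`, and at most `l` times as much up to index `l`. -/
lemma sub_le_sub_and_sub_le_mul_sub {f g : ℕ → ℝ} (hf : Antitone f)
    (hg : ∀ k : ℕ, g (k + 1) - g k = (k + 1) * (f (k + 1) - f k)) {k l : ℕ} (hkl : k ≤ l) :
    f k - f l ≤ g k - g l ∧ g k - g l ≤ l * (f k - f l) := by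
  induction l, hkl using Nat.le_induction with
  | base => simp
  | succ l hkl ih =>
    have hstep : f (l + 1) ≤ f l := hf l.le_succ
    have hkl' : f l ≤ f k := hf hkl
    have hmul : 0 ≤ (l : ℝ) * (f l - f (l + 1)) :=
      mul_nonneg l.cast_nonneg (sub_nonneg.2 hstep)
    have := hg l
    push_cast
    constructor <;> nlinarith [ih.1, ih.2]

/-- The map `Phi2` in sorted coordinates, for sequences indexed by `ℕ`. -/
def phiSeq (f : ℕ → ℝ) (k : ℕ) : ℝ :=
  if k = 0 then f k else k * f k - ∑ m ∈ Finset.Ico 1 k, f m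

lemma phiSeq_succ_sub (f : ℕ → ℝ) (k : ℕ) :
    phiSeq f (k + 1) - phiSeq f k = (k + 1) * (f (k + 1) - f k) := by
  rcases Nat.eq_zero_or_pos k with rfl | hk
  · simp [phiSeq]
  · rw [phiSeq, phiSeq, if_neg k.succ_ne_zero, if_neg hk.ne', Finset.sum_Ico_succ_top hk]
    push_cast
    ring

lemma eq_iff_phiSeq_eq {f : ℕ → ℝ} (hf : Antitone f) (k l : ℕ) :
    f k = f l ↔ phiSeq f k = phiSeq f l := by
  wlog hkl : k ≤ l generalizing k l
  · rw [eq_comm, this l k (le_of_not_ge hkl), eq_comm]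
  obtain ⟨hlow, hupp⟩ := sub_le_sub_and_sub_le_mul_sub hf (phiSeq_succ_sub f) hkl
  have hanti : f l ≤ f k := hf hkl
  constructor <;> intro h
  · rw [h, sub_self, mul_zero] at hupp
    linarith
  · linarith

lemma Phi2_eq_phiSeq {n : ℕ} (σ : Equiv.Perm (Fin n)) (a : Fin n → ℝ) {f : ℕ → ℝ}
    (hf : ∀ k : Fin n, f k = a (σ k)) (i : Fin n) :
    Phi2 n σ a i = phiSeq f (σ.symm i) := by
  have hsum : ∑ m ∈ Finset.univ.filter
      (fun m : Fin n => 1 ≤ m.val ∧ m.val < (σ.symm i).val), a (σ m) =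
      ∑ m ∈ Finset.Ico 1 (σ.symm i).val, f m := by
    refine Finset.sum_nbij Fin.val (by simp) Fin.val_injective.injOn ?_ fun m _ => (hf m).symm
    intro m hm
    have hm' := Finset.mem_Ico.1 (Finset.mem_coe.1 hm)
    exact ⟨⟨m, hm'.2.trans (σ.symm i).isLt⟩,
      Finset.mem_coe.2 (Finset.mem_filter.2 ⟨Finset.mem_univ _, hm'⟩), rfl⟩
  rw [Phi2, phiSeq, hsum, hf, Equiv.apply_symm_apply]

/-- Let `a ∈ G_σ` and `c = Φ_{2,σ}(a)`. Then for all `i < j`, `aᵢ = aⱼ ↔ cᵢ = cⱼ`. -/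
theorem stmt5 (n : ℕ) (hn : 2 ≤ n) (σ : Equiv.Perm (Fin n)) (a : Fin n → ℝ)
    (ha : a ∈ Gsig n σ) (i j : Fin n) (hij : i < j) :
    a i = a j ↔ Phi2 n σ a i = Phi2 n σ a j := by
  let f : ℕ → ℝ := fun k => a (σ ⟨min k (n - 1), by omega⟩)
  have hf : Antitone f := fun k l hkl => ha.2.2 _ _ (Fin.mk_le_mk.2 (by omega))
  have hval : ∀ k : Fin n, f k = a (σ k) := fun k => by
    have hk : min k.val (n - 1) = k.val := by omega
    simp [f, hk]
  rw [Phi2_eq_phiSeq σ a hval, Phi2_eq_phiSeq σ a hval, ← eq_iff_phiSeq_eq hf, hval, hval,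
    Equiv.apply_symm_apply, Equiv.apply_symm_apply]
end
end

section
/- If σ and τ are permutations of {1,…,n} and a ∈ G_σ ∩ G_τ, then Φ_{2,σ}(a) = Φ_{2,τ}(a); consequently, since G = ⋃_σ G_σ and F = ⋃_σ F_σ, the map Φ₂ : G → F defined by Φ₂(a) = Φ_{2,σ}(a) whenever a ∈ G_σ is well defined, and Φ₂ is a bijection from G onto F. -/
noncomputable section

/-- The permutation-free form of `Φ₂`: the `i`-th coordinate is `1 - ∑ⱼ (aⱼ - aᵢ)⁺`. -/
def excessMap {n : ℕ} (a : Fin n → ℝ) : Fin n → ℝ := fun i => 1 - ∑ j, max (a j - a i) 0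

theorem excessMap_le_one {n : ℕ} (a : Fin n → ℝ) (i : Fin n) : excessMap a i ≤ 1 := by
  have : 0 ≤ ∑ j, max (a j - a i) 0 := Finset.sum_nonneg fun j _ => le_max_right _ _
  unfold excessMap
  linarith

theorem excessMap_strictMono {n : ℕ} {a : Fin n → ℝ} {i j : Fin n} (h : a i < a j) :
    excessMap a i < excessMap a j := by
  refine sub_lt_sub_left (Finset.sum_lt_sum (fun l _ => ?_) ⟨j, Finset.mem_univ j, ?_⟩) 1
  · gcongr
  · rw [sub_self, max_self]
    exact lt_max_of_lt_left (sub_pos.2 h)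

theorem sum_max_sub_eq_sum_range {n : ℕ} {b : ℕ → ℝ} (hb : ∀ k l, k ≤ l → l < n → b l ≤ b k)
    {k : ℕ} (hk : k < n) :
    ∑ j : Fin n, max (b j - b k) 0 = ∑ j ∈ Finset.range k, (b j - b k) := by
  rw [Fin.sum_univ_eq_sum_range (fun j => max (b j - b k) 0) n,
    ← Finset.sum_range_add_sum_Ico _ hk.le,
    Finset.sum_eq_zero (s := Finset.Ico k n), add_zero]
  · refine Finset.sum_congr rfl fun j hj => max_eq_left (sub_nonneg.2 ?_)
    exact hb _ _ (Finset.mem_range.1 hj).le hk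
  · intro j hj
    rw [Finset.mem_Ico] at hj
    exact max_eq_right (sub_nonpos.2 (hb _ _ hj.1 hj.2))

theorem Phi2_eq_excessMap {n : ℕ} {σ : Equiv.Perm (Fin n)} {a : Fin n → ℝ} (ha : a ∈ Gsig n σ) :
    Phi2 n σ a = excessMap a := by
  obtain ⟨-, h0, hanti⟩ := ha
  ext i
  obtain ⟨k, rfl⟩ := σ.surjective i
  have hn : 0 < n := k.pos
  have hsum : ∑ j, max (a j - a (σ k)) 0 =
      ∑ m ∈ Finset.univ.filter (fun m : Fin n => m < k), (a (σ m) - a (σ k)) := by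
    rw [← Equiv.sum_comp σ, Finset.sum_filter]
    refine Finset.sum_congr rfl fun m _ => ?_
    split_ifs with hm
    · exact max_eq_left (sub_nonneg.2 (hanti _ _ hm.le))
    · exact max_eq_right (sub_nonpos.2 (hanti _ _ (not_lt.1 hm)))
  unfold Phi2 excessMap
  rw [hsum, Equiv.symm_apply_apply]
  split_ifs with hk
  · rw [h0 k hk, Finset.filter_false_of_mem, Finset.sum_empty, sub_zero]
    intro m _ hm
    exact absurd (Fin.lt_def.1 hm) (by omega)
  · have hinsert : Finset.univ.filter (fun m : Fin n => m < k) = insert ⟨0, hn⟩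
        (Finset.univ.filter (fun m : Fin n => 1 ≤ m.val ∧ m.val < k.val)) := by
      ext m
      simp only [Finset.mem_filter, Finset.mem_univ, true_and, Finset.mem_insert, Fin.lt_def,
        Fin.ext_iff]
      omega
    have hcard : ((Finset.univ.filter (fun m : Fin n => m < k)).card : ℝ) = k := by
      rw [Finset.filter_gt_eq_Iio, Fin.card_Iio]
    rw [Finset.sum_sub_distrib, Finset.sum_const, nsmul_eq_mul, hcard, hinsert,
      Finset.sum_insert (by simp), h0 ⟨0, hn⟩ rfl]
    ring

theorem exists_perm_antitone {n : ℕ} {c : Fin n → ℝ} (hc : c ∈ Fset n) :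
    ∃ σ : Equiv.Perm (Fin n), (∀ k : Fin n, k.val = 0 → c (σ k) = 1) ∧
      ∀ k l : Fin n, k ≤ l → c (σ l) ≤ c (σ k) := by
  obtain ⟨hH, i, hi⟩ := hc
  have hmono := Tuple.monotone_sort (fun j => -c j)
  set σ := Tuple.sort (fun j => -c j)
  have hanti : ∀ k l : Fin n, k ≤ l → c (σ l) ≤ c (σ k) := fun k l hkl =>
    neg_le_neg_iff.1 (hmono hkl)
  refine ⟨σ, fun k hk => le_antisymm (hH _).2 ?_, hanti⟩
  have := hanti k (σ.symm i) (Fin.le_def.2 (by omega))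
  rwa [Equiv.apply_symm_apply, hi] at this

theorem Gset_eq_iUnion (n : ℕ) : Gset n = ⋃ σ : Equiv.Perm (Fin n), Gsig n σ := by
  ext a
  rw [Set.mem_iUnion]
  exact ⟨fun ha => (exists_perm_antitone ha.1).imp fun _ hσ => ⟨ha, hσ⟩, fun ⟨_, h⟩ => h.1⟩

theorem Fset_eq_iUnion (n : ℕ) : Fset n = ⋃ σ : Equiv.Perm (Fin n), Fsig n σ := by
  ext a
  rw [Set.mem_iUnion]
  exact ⟨fun ha => (exists_perm_antitone ha).imp fun _ hσ => ⟨ha, hσ⟩, fun ⟨_, h⟩ => h.1⟩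

theorem excessMap_mapsTo (n : ℕ) : Set.MapsTo excessMap (Gset n) (Fset n) := by
  rintro a ⟨⟨hH, i₀, hi₀⟩, hG⟩
  refine ⟨fun i => ⟨?_, excessMap_le_one a i⟩, i₀, ?_⟩
  · obtain ⟨m, -, hm⟩ := Finset.exists_min_image Finset.univ a ⟨i₀, Finset.mem_univ _⟩
    have hle : ∑ j, max (a j - a i) 0 ≤ ∑ j, (a j - a m) :=
      Finset.sum_le_sum fun j hj =>
        max_le (sub_le_sub_left (hm i (Finset.mem_univ i)) _) (sub_nonneg.2 (hm j hj))
    rw [Finset.sum_sub_distrib, Finset.sum_const, nsmul_eq_mul, Finset.card_univ,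
      Fintype.card_fin] at hle
    have := hG m
    unfold excessMap
    linarith
  · have : ∑ j, max (a j - a i₀) 0 = 0 :=
      Finset.sum_eq_zero fun j _ => max_eq_right (by linarith [(hH j).2])
    unfold excessMap
    rw [this, sub_zero]

theorem le_of_excessMap_eq {n : ℕ} {a b : Fin n → ℝ} (ha : a ∈ Fset n) (hb : b ∈ Fset n)
    (h : excessMap a = excessMap b) {i : Fin n}
    (hi : ∀ j, excessMap a i < excessMap a j → a j = b j) : b i ≤ a i := by
  by_contra! hlt
  obtain ⟨-, j₀, hj₀⟩ := ha
  have hai : a i < a j₀ := by linarith [(hb.1 i).2]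
  have hbj₀ := hi j₀ (excessMap_strictMono hai)
  have hsum : ∑ j, max (b j - b i) 0 < ∑ j, max (a j - a i) 0 := by
    refine Finset.sum_lt_sum (fun j _ => ?_) ⟨j₀, Finset.mem_univ _, ?_⟩
    · by_cases hj : excessMap a i < excessMap a j
      · rw [hi j hj]
        gcongr
      · have hbj : b j ≤ b i := by
          by_contra! hbj
          exact hj (h ▸ excessMap_strictMono hbj)
        rw [max_eq_right (sub_nonpos.2 hbj)]
        exact le_max_right _ _
    · rw [← hbj₀]
      exact max_lt (lt_max_of_lt_left (by linarith)) (lt_max_of_lt_left (by linarith))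
  have := congrFun h i
  unfold excessMap at this
  linarith

theorem excessMap_injOn (n : ℕ) : Set.InjOn excessMap (Fset n) := by
  intro a ha b hb h
  by_contra hne
  obtain ⟨i₀, hi₀⟩ := Function.ne_iff.1 hne
  obtain ⟨i, hi, hmax⟩ := Finset.exists_max_image (Finset.univ.filter fun i => a i ≠ b i)
    (excessMap a) ⟨i₀, by simpa using hi₀⟩
  have hagree : ∀ j, excessMap a i < excessMap a j → a j = b j := by
    intro j hj
    by_contra hab
    exact absurd (hmax j (by simpa using hab)) (not_le.2 hj)
  refine (Finset.mem_filter.1 hi).2 (le_antisymm ?_ (le_of_excessMap_eq ha hb h hagree))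
  exact le_of_excessMap_eq hb ha h.symm fun j hj => (hagree j (h ▸ hj)).symm

theorem sum_range_sub_of_step {b d : ℕ → ℝ}
    (h : ∀ k, b (k + 1) = b k - (d k - d (k + 1)) / (k + 1)) (k : ℕ) :
    ∑ j ∈ Finset.range k, (b j - b k) = d 0 - d k := by
  induction k with
  | zero => simp
  | succ k ih =>
    rw [Finset.sum_sub_distrib, Finset.sum_const, Finset.card_range, nsmul_eq_mul] at ih ⊢
    rw [Finset.sum_range_succ, h]
    push_cast
    field_simp
    linarith

theorem exists_excessMap_eq {n : ℕ} {c : Fin n → ℝ} (hc : c ∈ Fset n) :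
    ∃ a ∈ Fset n, excessMap a = c := by
  obtain ⟨σ, h0, hanti⟩ := exists_perm_antitone hc
  obtain ⟨hH, i₀, -⟩ := hc
  have hn : 0 < n := i₀.pos
  let d : ℕ → ℝ := fun k => if h : k < n then c (σ ⟨k, h⟩) else 0
  have hd : ∀ k : Fin n, d k = c (σ k) := fun k => dif_pos k.2
  have hd0 : d 0 = 1 := (dif_pos hn).trans (h0 _ rfl)
  have hdnonneg : ∀ k, 0 ≤ d k := by
    intro k
    by_cases hk : k < n
    · exact (hH _).1.trans_eq (hd ⟨k, hk⟩).symm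
    · exact (dif_neg hk : d k = 0).ge
  have hdstep : ∀ k, 0 ≤ d k - d (k + 1) := by
    intro k
    rw [sub_nonneg]
    by_cases hk : k + 1 < n
    · rw [hd ⟨k + 1, hk⟩, hd ⟨k, by omega⟩]
      exact hanti _ _ (Fin.le_def.2 (Nat.le_succ k))
    · exact (dif_neg hk).trans_le (hdnonneg k)
  let b : ℕ → ℝ := fun k => 1 - ∑ m ∈ Finset.range k, (d m - d (m + 1)) / (m + 1)
  have hb : ∀ k, b (k + 1) = b k - (d k - d (k + 1)) / (k + 1) := by
    intro k
    simp only [b, Finset.sum_range_succ]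
    ring
  have hb0 : b 0 = 1 := by simp [b]
  have hbanti : Antitone b := antitone_nat_of_succ_le fun k => by
    rw [hb]
    exact sub_le_self _ (div_nonneg (hdstep k) (by positivity))
  have hbd : ∀ k, d k ≤ b k := by
    intro k
    induction k with
    | zero => rw [hd0, hb0]
    | succ k ih =>
      have : (d k - d (k + 1)) / (k + 1) ≤ d k - d (k + 1) :=
        div_le_self (hdstep k) (by linarith [k.cast_nonneg (α := ℝ)])
      rw [hb]
      linarith
  refine ⟨fun i => b (σ.symm i), ⟨fun i => ⟨(hdnonneg _).trans (hbd _), ?_⟩, σ ⟨0, hn⟩, ?_⟩, ?_⟩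
  · exact (hbanti (Nat.zero_le _)).trans_eq hb0
  · simpa using hb0
  · ext i
    unfold excessMap
    rw [Equiv.sum_comp σ.symm (fun j : Fin n => max (b j - b (σ.symm i)) 0),
      sum_max_sub_eq_sum_range (fun k l hkl _ => hbanti hkl) (σ.symm i).2,
      sum_range_sub_of_step hb, hd0, hd, Equiv.apply_symm_apply]
    ring

theorem mem_Gset_of_excessMap_nonneg {n : ℕ} {a : Fin n → ℝ} (ha : a ∈ Fset n)
    (h : ∀ i, 0 ≤ excessMap a i) : a ∈ Gset n := by
  refine ⟨ha, fun i => ?_⟩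
  have hle : ∑ j, (a j - a i) ≤ ∑ j, max (a j - a i) 0 :=
    Finset.sum_le_sum fun j _ => le_max_left _ _
  rw [Finset.sum_sub_distrib, Finset.sum_const, nsmul_eq_mul, Finset.card_univ,
    Fintype.card_fin] at hle
  have := h i
  unfold excessMap at this
  linarith

theorem excessMap_bijOn (n : ℕ) : Set.BijOn excessMap (Gset n) (Fset n) := by
  refine ⟨excessMap_mapsTo n, (excessMap_injOn n).mono fun _ ha => ha.1, fun c hc => ?_⟩
  obtain ⟨a, ha, rfl⟩ := exists_excessMap_eq hc
  exact ⟨a, mem_Gset_of_excessMap_nonneg ha fun i => (hc.1 i).1, rfl⟩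

/-- If `a ∈ G_σ ∩ G_τ` then `Φ_{2,σ}(a) = Φ_{2,τ}(a)`; moreover `G = ⋃_σ G_σ` and
`F = ⋃_σ F_σ`, so the map `Φ₂ : G → F` given by `Φ₂(a) = Φ_{2,σ}(a)` for `a ∈ G_σ`
is well defined, and any such map is a bijection from `G` onto `F`. -/
theorem stmt6 (n : ℕ) (hn : 2 ≤ n) :
    (∀ σ τ : Equiv.Perm (Fin n), ∀ a : Fin n → ℝ,
      a ∈ Gsig n σ → a ∈ Gsig n τ → Phi2 n σ a = Phi2 n τ a) ∧
    Gset n = ⋃ σ : Equiv.Perm (Fin n), Gsig n σ ∧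
    Fset n = ⋃ σ : Equiv.Perm (Fin n), Fsig n σ ∧
    ∀ Φ₂ : (Fin n → ℝ) → (Fin n → ℝ),
      (∀ σ : Equiv.Perm (Fin n), ∀ a ∈ Gsig n σ, Φ₂ a = Phi2 n σ a) →
      Set.BijOn Φ₂ (Gset n) (Fset n) := by
  refine ⟨fun σ τ a hσ hτ => (Phi2_eq_excessMap hσ).trans (Phi2_eq_excessMap hτ).symm,
    Gset_eq_iUnion n, Fset_eq_iUnion n, fun Φ₂ hΦ => (excessMap_bijOn n).congr fun a ha => ?_⟩
  rw [Gset_eq_iUnion, Set.mem_iUnion] at ha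
  obtain ⟨σ, hσ⟩ := ha
  rw [hΦ σ a hσ, Phi2_eq_excessMap hσ]
end
end

section
/- One has Ψ₀(F) = Ψ₀(H) = P, the restriction Ψ₀|_F : F → P is bijective, and its inverse P → F is given by b ↦ b + (1 − maxᵢ bᵢ)·u. -/
noncomputable section

/-- The point `g = (1/n)·u`. -/
def gpt (n : ℕ) : Fin n → ℝ := fun _ => 1 / (n : ℝ)

/-- `Ψ₀(a) = a + (1/n)(1 − (a₁ + ⋯ + aₙ))·u`, the orthogonal projection onto the
hyperplane `Π = {x : x₁ + ⋯ + xₙ = 1}`. -/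
def Psi0 (n : ℕ) (a : Fin n → ℝ) : Fin n → ℝ := a + ((1 - ∑ i, a i) / (n : ℝ)) • uvec n

/-- `P = Ψ₀(H)`. -/
def Pset (n : ℕ) : Set (Fin n → ℝ) := Psi0 n '' Hset n

lemma Psi0_add_smul_uvec {n : ℕ} [NeZero n] (a : Fin n → ℝ) (c : ℝ) :
    Psi0 n (a + c • uvec n) = Psi0 n a := by
  have hn : (n : ℝ) ≠ 0 := NeZero.ne _
  ext i
  simp only [Psi0, uvec, Pi.add_apply, Pi.smul_apply, smul_eq_mul, mul_one,
    Finset.sum_add_distrib, Finset.sum_const, Finset.card_univ, Fintype.card_fin, nsmul_eq_mul]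
  field_simp
  ring

/-- The translate of `b` along `u` whose largest coordinate is `1`. -/
def maxNormalize {n : ℕ} (b : Fin n → ℝ) : Fin n → ℝ := b + (1 - ⨆ i, b i) • uvec n

lemma maxNormalize_add_smul_uvec {n : ℕ} [NeZero n] (a : Fin n → ℝ) (c : ℝ) :
    maxNormalize (a + c • uvec n) = maxNormalize a := by
  have hsup : ⨆ i, (a + c • uvec n) i = (⨆ i, a i) + c := by
    simpa [uvec] using (ciSup_add (Set.finite_range a).bddAbove c).symm
  rw [maxNormalize, hsup]
  ext i
  simp [maxNormalize, uvec]
  ring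

lemma Psi0_maxNormalize {n : ℕ} [NeZero n] (b : Fin n → ℝ) :
    Psi0 n (maxNormalize b) = Psi0 n b :=
  Psi0_add_smul_uvec _ _

lemma maxNormalize_Psi0 {n : ℕ} [NeZero n] (a : Fin n → ℝ) :
    maxNormalize (Psi0 n a) = maxNormalize a :=
  maxNormalize_add_smul_uvec _ _

lemma Psi0_Psi0 {n : ℕ} [NeZero n] (a : Fin n → ℝ) : Psi0 n (Psi0 n a) = Psi0 n a :=
  Psi0_add_smul_uvec _ _

lemma maxNormalize_mem_Fset {n : ℕ} [NeZero n] {a : Fin n → ℝ} (ha : a ∈ Hset n) :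
    maxNormalize a ∈ Fset n := by
  have hle (i) : a i ≤ ⨆ j, a j := le_ciSup (Set.finite_range a).bddAbove i
  have hsup : ⨆ j, a j ≤ 1 := ciSup_le fun i => (ha i).2
  obtain ⟨j, hj⟩ := exists_eq_ciSup_of_finite (f := a)
  refine ⟨fun i => ?_, j, ?_⟩
  · simp only [maxNormalize, uvec, Pi.add_apply, Pi.smul_apply, smul_eq_mul, mul_one]
    constructor <;> linarith [hle i, (ha i).1]
  · simp [maxNormalize, uvec, hj]

lemma maxNormalize_eq_self {n : ℕ} [NeZero n] {a : Fin n → ℝ} (ha : a ∈ Fset n) :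
    maxNormalize a = a := by
  obtain ⟨hH, j, hj⟩ := ha
  have hsup : ⨆ i, a i = 1 :=
    le_antisymm (ciSup_le fun i => (hH i).2) (hj ▸ le_ciSup (Set.finite_range a).bddAbove j)
  simp [maxNormalize, hsup]

/-- `Ψ₀(F) = Ψ₀(H) = P`, the restriction `Ψ₀|_F : F → P` is bijective, and its inverse
`P → F` is `b ↦ b + (1 − maxᵢ bᵢ)·u`. -/
theorem stmt7 (n : ℕ) (hn : 2 ≤ n) :
    Psi0 n '' Fset n = Pset n ∧
    Set.BijOn (Psi0 n) (Fset n) (Pset n) ∧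
    (∀ b ∈ Pset n, b + (1 - ⨆ i, b i) • uvec n ∈ Fset n ∧
      Psi0 n (b + (1 - ⨆ i, b i) • uvec n) = b) ∧
    (∀ a ∈ Fset n, Psi0 n a + (1 - ⨆ i, Psi0 n a i) • uvec n = a) := by
  have : NeZero n := ⟨by omega⟩
  have hinv : ∀ b ∈ Pset n, maxNormalize b ∈ Fset n ∧ Psi0 n (maxNormalize b) = b := by
    rintro _ ⟨a, ha, rfl⟩
    rw [Psi0_maxNormalize, maxNormalize_Psi0]
    exact ⟨maxNormalize_mem_Fset ha, Psi0_Psi0 a⟩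
  have hleft : ∀ a ∈ Fset n, maxNormalize (Psi0 n a) = a := fun a ha => by
    rw [maxNormalize_Psi0, maxNormalize_eq_self ha]
  have hbij : Set.BijOn (Psi0 n) (Fset n) (Pset n) :=
    Set.InvOn.bijOn ⟨hleft, fun b hb => (hinv b hb).2⟩
      (fun a ha => Set.mem_image_of_mem _ ha.1) fun b hb => (hinv b hb).1
  exact ⟨hbij.image_eq, hbij, hinv, hleft⟩
end
end

section
/- The map Ψ : F → ℝⁿ defined by Ψ = c_{1/(n−1)} ∘ Ψ₀|_F satisfies Ψ(a) = (1/(n−1))·a − ((a₁ + ⋯ + aₙ)/(n(n−1)))·u + (1/n)·u for all a ∈ F; moreover Ψ maps F into K, Ψ is injective, and for every a ∈ F one has (n−1)·(Ψ(a) − (maxᵢ Ψ(a)ᵢ)·u) + u = a, i.e., the map b ↦ (n−1)·(b − (maxᵢ bᵢ)·u) + u inverts Ψ on its image. -/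
noncomputable section

/-- For `ε > 0`, the homothety `c_ε(b) = ε·b + (1−ε)·g` of center `g`. -/
def ceps (n : ℕ) (ε : ℝ) (b : Fin n → ℝ) : Fin n → ℝ := ε • b + (1 - ε) • gpt n

theorem ceps_Psi0_apply {n : ℕ} (hn : 2 ≤ n) (a : Fin n → ℝ) (i : Fin n) :
    ceps n (1 / ((n : ℝ) - 1)) (Psi0 n a) i
      = (1 / ((n : ℝ) - 1)) * a i - (∑ j, a j) / ((n : ℝ) * ((n : ℝ) - 1)) + 1 / (n : ℝ) := by
  have h2 : (2 : ℝ) ≤ n := by exact_mod_cast hn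
  have hn0 : (n : ℝ) ≠ 0 := by linarith
  have hn1 : (n : ℝ) - 1 ≠ 0 := by linarith
  simp only [ceps, Psi0, gpt, uvec, Pi.add_apply, Pi.smul_apply, smul_eq_mul]
  field_simp
  ring

theorem ceps_Psi0_mem_Kset {n : ℕ} (hn : 2 ≤ n) {a : Fin n → ℝ} (ha : a ∈ Hset n) :
    ceps n (1 / ((n : ℝ) - 1)) (Psi0 n a) ∈ Kset n := by
  have h2 : (2 : ℝ) ≤ n := by exact_mod_cast hn
  have hn0 : (n : ℝ) ≠ 0 := by linarith
  have hn1 : (n : ℝ) - 1 ≠ 0 := by linarith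
  have hpos : 0 < (n : ℝ) * ((n : ℝ) - 1) := mul_pos (by linarith) (by linarith)
  refine ⟨fun i => ?_, ?_⟩
  · have hlow : a i ≤ ∑ j, a j :=
      Finset.single_le_sum (fun j _ => (ha j).1) (Finset.mem_univ i)
    have hupp : 1 - a i ≤ ∑ j, (1 - a j) :=
      Finset.single_le_sum (f := fun j => 1 - a j)
        (fun j _ => sub_nonneg.2 (ha j).2) (Finset.mem_univ i)
    simp only [Finset.sum_sub_distrib, Finset.sum_const, Finset.card_univ, Fintype.card_fin,
      nsmul_eq_mul, mul_one] at hupp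
    have key : ceps n (1 / ((n : ℝ) - 1)) (Psi0 n a) i
        = ((n : ℝ) * a i - ∑ j, a j + (n - 1)) / ((n : ℝ) * ((n : ℝ) - 1)) := by
      rw [ceps_Psi0_apply hn]
      field_simp
    obtain ⟨h0, h1⟩ := ha i
    rw [key]
    constructor
    · apply div_nonneg _ hpos.le
      nlinarith
    · rw [div_le_one hpos]
      nlinarith
  · simp only [ceps_Psi0_apply hn, Finset.sum_add_distrib, Finset.sum_sub_distrib,
      ← Finset.mul_sum, Finset.sum_const, Finset.card_univ, Fintype.card_fin, nsmul_eq_mul]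
    field_simp
    ring

theorem ceps_Psi0_left_inverse {n : ℕ} (hn : 2 ≤ n) {a : Fin n → ℝ} (ha : a ∈ Fset n) :
    ((n : ℝ) - 1) • ((ceps n (1 / ((n : ℝ) - 1)) (Psi0 n a))
      - (⨆ i, ceps n (1 / ((n : ℝ) - 1)) (Psi0 n a) i) • uvec n) + uvec n = a := by
  have h2 : (2 : ℝ) ≤ n := by exact_mod_cast hn
  have hn1 : (n : ℝ) - 1 ≠ 0 := by linarith
  obtain ⟨haH, k, hk⟩ := ha
  have hsup : (⨆ i, ceps n (1 / ((n : ℝ) - 1)) (Psi0 n a) i)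
      = ceps n (1 / ((n : ℝ) - 1)) (Psi0 n a) k := by
    have : Nonempty (Fin n) := ⟨k⟩
    refine le_antisymm (ciSup_le fun i => ?_) (le_ciSup (Set.finite_range _).bddAbove k)
    rw [ceps_Psi0_apply hn, ceps_Psi0_apply hn, hk]
    have := (haH i).2
    have : 0 ≤ 1 / ((n : ℝ) - 1) := one_div_nonneg.2 (by linarith)
    gcongr
  rw [hsup]
  ext i
  simp only [Pi.add_apply, Pi.sub_apply, Pi.smul_apply, smul_eq_mul, uvec, ceps_Psi0_apply hn, hk]
  field_simp
  ring

/-- `Ψ = c_{1/(n−1)} ∘ Ψ₀|_F` satisfies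
`Ψ(a) = (1/(n−1))·a − ((a₁+⋯+aₙ)/(n(n−1)))·u + (1/n)·u`; it maps `F` into `K`, is
injective on `F`, and `b ↦ (n−1)·(b − (maxᵢ bᵢ)·u) + u` inverts it on its image. -/
theorem stmt8 (n : ℕ) (hn : 2 ≤ n) :
    (∀ a ∈ Fset n, ceps n (1 / ((n : ℝ) - 1)) (Psi0 n a)
      = (1 / ((n : ℝ) - 1)) • a - ((∑ i, a i) / ((n : ℝ) * ((n : ℝ) - 1))) • uvec n
        + (1 / (n : ℝ)) • uvec n) ∧
    (∀ a ∈ Fset n, ceps n (1 / ((n : ℝ) - 1)) (Psi0 n a) ∈ Kset n) ∧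
    Set.InjOn (fun a => ceps n (1 / ((n : ℝ) - 1)) (Psi0 n a)) (Fset n) ∧
    (∀ a ∈ Fset n,
      ((n : ℝ) - 1) • ((ceps n (1 / ((n : ℝ) - 1)) (Psi0 n a))
          - (⨆ i, ceps n (1 / ((n : ℝ) - 1)) (Psi0 n a) i) • uvec n) + uvec n = a) := by
  refine ⟨fun a _ => ?_, fun a ha => ceps_Psi0_mem_Kset hn ha.1, fun a ha b hb hab => ?_,
    fun a ha => ceps_Psi0_left_inverse hn ha⟩
  · ext i
    rw [ceps_Psi0_apply hn]
    simp [uvec]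
  · dsimp only at hab
    rw [← ceps_Psi0_left_inverse hn ha, hab, ceps_Psi0_left_inverse hn hb]
end
end

section
/- The image of the map Ψ : F → K, Ψ(a) = (1/(n−1))·a − ((a₁ + ⋯ + aₙ)/(n(n−1)))·u + (1/n)·u, equals the convex hull of the finite set Ā = { (1/(n−1))·( (n−1−s)/n + α₁, …, (n−1−s)/n + αₙ ) : α₁,…,αₙ ∈ {0,1}, s = α₁ + ⋯ + αₙ }. -/
noncomputable section

/-- The map `Ψ(a) = (1/(n−1))·a − ((a₁+⋯+aₙ)/(n(n−1)))·u + (1/n)·u`. -/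
def PsiMap (n : ℕ) (a : Fin n → ℝ) : Fin n → ℝ :=
  (1 / ((n : ℝ) - 1)) • a - ((∑ i, a i) / ((n : ℝ) * ((n : ℝ) - 1))) • uvec n
    + (1 / (n : ℝ)) • uvec n

/-- `PsiMap` as an affine map. -/
def PsiAffine (n : ℕ) : (Fin n → ℝ) →ᵃ[ℝ] (Fin n → ℝ) where
  toFun := PsiMap n
  linear :=
    { toFun := fun a => (1 / ((n : ℝ) - 1)) • a -
        ((∑ i, a i) / ((n : ℝ) * ((n : ℝ) - 1))) • uvec n
      map_add' := fun a b => by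
        ext i
        simp only [Pi.add_apply, Pi.sub_apply, Pi.smul_apply, smul_eq_mul, Finset.sum_add_distrib]
        ring
      map_smul' := fun c a => by
        ext i
        simp only [Pi.sub_apply, Pi.smul_apply, smul_eq_mul, ← Finset.mul_sum, RingHom.id_apply]
        ring }
  map_vadd' := fun a b => by
    ext i
    simp only [PsiMap, vadd_eq_add, LinearMap.coe_mk, AddHom.coe_mk, Pi.add_apply, Pi.sub_apply,
      Pi.smul_apply, smul_eq_mul, Finset.sum_add_distrib]
    ring

theorem coe_PsiAffine (n : ℕ) : ⇑(PsiAffine n) = PsiMap n := rfl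

theorem PsiMap_eq (n : ℕ) (hn : 2 ≤ n) (a : Fin n → ℝ) :
    PsiMap n a =
      (1 / ((n : ℝ) - 1)) • fun i => ((n : ℝ) - 1 - ∑ j, a j) / (n : ℝ) + a i := by
  have h2 : (2 : ℝ) ≤ n := by exact_mod_cast hn
  have h0 : (n : ℝ) ≠ 0 := by linarith
  have h1 : (n : ℝ) - 1 ≠ 0 := by linarith
  ext i
  simp only [PsiMap, uvec, Pi.add_apply, Pi.sub_apply, Pi.smul_apply, smul_eq_mul]
  field_simp
  ring

theorem PsiMap_add_smul_uvec (n : ℕ) (hn : n ≠ 0) (a : Fin n → ℝ) (t : ℝ) :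
    PsiMap n (a + t • uvec n) = PsiMap n a := by
  have h0 : (n : ℝ) ≠ 0 := by exact_mod_cast hn
  have hs : ((∑ i, a i) + n * t) / ((n : ℝ) * ((n : ℝ) - 1)) =
      (∑ i, a i) / ((n : ℝ) * ((n : ℝ) - 1)) + t * (1 / ((n : ℝ) - 1)) := by
    rw [add_div, mul_div_mul_left _ _ h0, mul_one_div]
  ext i
  simp only [PsiMap, uvec, Pi.add_apply, Pi.sub_apply, Pi.smul_apply, smul_eq_mul, mul_one,
    Finset.sum_add_distrib, Finset.sum_const, Finset.card_univ, Fintype.card_fin, nsmul_eq_mul, hs]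
  ring

theorem PsiMap_image_Fset (n : ℕ) (hn : n ≠ 0) : PsiMap n '' Fset n = PsiMap n '' Hset n := by
  refine (Set.image_mono fun x hx => hx.1).antisymm ?_
  rintro _ ⟨a, ha, rfl⟩
  have : Nonempty (Fin n) := ⟨⟨0, Nat.pos_of_ne_zero hn⟩⟩
  obtain ⟨m, hm⟩ := Finite.exists_max a
  refine ⟨a + (1 - a m) • uvec n, ⟨fun i => ?_, m, ?_⟩, PsiMap_add_smul_uvec n hn a _⟩
  · simp only [uvec, Pi.add_apply, Pi.smul_apply, smul_eq_mul, mul_one]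
    exact ⟨by linarith [(ha i).1, (ha m).2], by linarith [hm i]⟩
  · simp [uvec]

theorem Hset_eq_convexHull (n : ℕ) :
    Hset n = convexHull ℝ {a : Fin n → ℝ | ∀ i, a i = 0 ∨ a i = 1} := by
  have h : {a : Fin n → ℝ | ∀ i, a i = 0 ∨ a i = 1} =
      Set.univ.pi fun _ => ({0, 1} : Set ℝ) := by
    ext a
    simp
  rw [h, convexHull_pi]
  ext a
  simp [Hset, convexHull_pair, segment_eq_Icc, Pi.le_def, forall_and]

/-- The image `Ψ(F)` equals the convex hull of the finite set
`Ā = { (1/(n−1))·((n−1−s)/n + α₁, …, (n−1−s)/n + αₙ) : αᵢ ∈ {0,1}, s = α₁ + ⋯ + αₙ }`. -/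
theorem stmt9 (n : ℕ) (hn : 2 ≤ n) :
    PsiMap n '' Fset n =
      convexHull ℝ {x : Fin n → ℝ | ∃ α : Fin n → ℝ, (∀ i, α i = 0 ∨ α i = 1) ∧
        x = (1 / ((n : ℝ) - 1)) • fun i => ((n : ℝ) - 1 - ∑ j, α j) / (n : ℝ) + α i} := by
  rw [PsiMap_image_Fset n (by omega), Hset_eq_convexHull, ← coe_PsiAffine n,
    AffineMap.image_convexHull]
  congr 1
  ext x
  constructor
  · rintro ⟨α, hα, rfl⟩
    exact ⟨α, hα, PsiMap_eq n hn α⟩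
  · rintro ⟨α, hα, rfl⟩
    exact ⟨α, hα, PsiMap_eq n hn α⟩
end
end

section
/- Let b ∈ P with b ≠ g. Then maxᵢ bᵢ > minᵢ bᵢ, the set {α ≥ 0 : α·(b − g) + g ∈ P} has a greatest element α(b), and α(b) = 1/(maxᵢ bᵢ − minᵢ bᵢ). -/
noncomputable section

/-- `P` is the set of points of the hyperplane `Π` whose coordinates differ by at most `1`. -/
theorem mem_Pset_iff {n : ℕ} (hn : n ≠ 0) {x : Fin n → ℝ} :
    x ∈ Pset n ↔ ∑ i, x i = 1 ∧ ∀ i j, x i - x j ≤ 1 := by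
  have : NeZero n := ⟨hn⟩
  have hn' : (n : ℝ) ≠ 0 := Nat.cast_ne_zero.mpr hn
  constructor
  · rintro ⟨a, ha, rfl⟩
    refine ⟨?_, fun i j => ?_⟩
    · simp only [Psi0, uvec, Pi.add_apply, Pi.smul_apply, smul_eq_mul, mul_one,
        Finset.sum_add_distrib, Finset.sum_const, Finset.card_univ, Fintype.card_fin, nsmul_eq_mul]
      field_simp
      ring
    · simp only [Psi0, uvec, Pi.add_apply, Pi.smul_apply]
      linarith [(ha i).2, (ha j).1]
  · rintro ⟨hsum, hdiff⟩
    obtain ⟨q, hq⟩ := Finite.exists_min x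
    refine ⟨fun i => x i - x q, fun i => ⟨sub_nonneg.mpr (hq i), hdiff i q⟩, ?_⟩
    ext i
    simp only [Psi0, uvec, Pi.add_apply, Pi.smul_apply, smul_eq_mul, mul_one,
      Finset.sum_sub_distrib, Finset.sum_const, Finset.card_univ, Fintype.card_fin, nsmul_eq_mul,
      hsum]
    field_simp
    ring

/-- Scaling a point of the hyperplane `Π` about `g` lands in `P` exactly when the scaled coordinate
differences are at most `1`. -/
theorem smul_sub_gpt_add_gpt_mem_Pset_iff {n : ℕ} (hn : n ≠ 0) {b : Fin n → ℝ}
    (hb : ∑ i, b i = 1) (α : ℝ) :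
    α • (b - gpt n) + gpt n ∈ Pset n ↔ ∀ i j, α * (b i - b j) ≤ 1 := by
  have hn' : (n : ℝ) ≠ 0 := Nat.cast_ne_zero.mpr hn
  have hsum : ∑ i, (α • (b - gpt n) + gpt n) i = 1 := by
    simp [gpt, Finset.sum_add_distrib, ← Finset.mul_sum, hb, hn']
  have hdiff (i j : Fin n) : (α • (b - gpt n) + gpt n) i - (α • (b - gpt n) + gpt n) j
      = α * (b i - b j) := by
    simp only [gpt, Pi.add_apply, Pi.smul_apply, Pi.sub_apply, smul_eq_mul]
    ring
  simp only [mem_Pset_iff hn, hsum, hdiff, true_and]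

/-- A constant point of the hyperplane `Π` is `g`. -/
theorem eq_gpt_of_forall_eq {n : ℕ} (hn : n ≠ 0) {b : Fin n → ℝ} (hb : ∑ i, b i = 1) {c : ℝ}
    (hc : ∀ i, b i = c) : b = gpt n := by
  have hn' : (n : ℝ) ≠ 0 := Nat.cast_ne_zero.mpr hn
  ext i
  simp only [hc, Finset.sum_const, Finset.card_univ, Fintype.card_fin, nsmul_eq_mul] at hb
  rw [hc, gpt, eq_div_iff hn', mul_comm, hb]

/-- For `b ∈ P` with `b ≠ g`: `maxᵢ bᵢ > minᵢ bᵢ`, and the set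
`{α ≥ 0 : α·(b − g) + g ∈ P}` has greatest element `α(b) = 1/(maxᵢ bᵢ − minᵢ bᵢ)`. -/
theorem stmt12 (n : ℕ) (hn : 2 ≤ n) (b : Fin n → ℝ) (hb : b ∈ Pset n) (hbg : b ≠ gpt n) :
    (⨅ i, b i) < (⨆ i, b i) ∧
    IsGreatest {α : ℝ | 0 ≤ α ∧ α • (b - gpt n) + gpt n ∈ Pset n}
      (1 / ((⨆ i, b i) - ⨅ i, b i)) := by
  have hn0 : n ≠ 0 := by omega
  have : NeZero n := ⟨hn0⟩
  have hsum := ((mem_Pset_iff hn0).mp hb).1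
  have hsup (i : Fin n) : b i ≤ ⨆ i, b i := le_ciSup (Set.finite_range b).bddAbove i
  have hinf (i : Fin n) : ⨅ i, b i ≤ b i := ciInf_le (Set.finite_range b).bddBelow i
  have hlt : (⨅ i, b i) < ⨆ i, b i := by
    by_contra! hle
    exact hbg (eq_gpt_of_forall_eq hn0 hsum fun i => le_antisymm ((hsup i).trans hle) (hinf i))
  have hpos : 0 < (⨆ i, b i) - ⨅ i, b i := sub_pos.mpr hlt
  simp only [smul_sub_gpt_add_gpt_mem_Pset_iff hn0 hsum]
  refine ⟨hlt, ⟨by positivity, fun i j => ?_⟩, fun α hα => ?_⟩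
  · rw [one_div_mul_eq_div, div_le_one hpos]
    linarith [hsup i, hinf j]
  · obtain ⟨p, hp⟩ := exists_eq_ciSup_of_finite (f := b)
    obtain ⟨q, hq⟩ := exists_eq_ciInf_of_finite (f := b)
    rw [le_div_iff₀ hpos, ← hp, ← hq]
    exact hα.2 p q
end
end

section
/- Let b ∈ P with b ≠ g. Then minᵢ bᵢ < 1/n, the set {β ≥ 0 : β·(b − g) + g ∈ K} has a greatest element β(b), and β(b) = 1/(1 − n·minᵢ bᵢ). -/
noncomputable section

/-- The map `Ψ₀` takes values in the hyperplane of vectors with coordinate sum `1`. -/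
theorem sum_Psi0 {n : ℕ} (hn : n ≠ 0) (a : Fin n → ℝ) : ∑ i, Psi0 n a i = 1 := by
  have hn' : (n : ℝ) ≠ 0 := Nat.cast_ne_zero.mpr hn
  simp only [Psi0, uvec, Pi.add_apply, Pi.smul_apply, smul_eq_mul, mul_one,
    Finset.sum_add_distrib, Finset.sum_const, Finset.card_univ, Fintype.card_fin, nsmul_eq_mul]
  field_simp
  ring

/-- A vector with coordinate sum `1` lies in `K` as soon as its coordinates are nonnegative. -/
theorem mem_Kset_of_nonneg {n : ℕ} {x : Fin n → ℝ} (h0 : ∀ i, 0 ≤ x i) (h1 : ∑ i, x i = 1) :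
    x ∈ Kset n :=
  ⟨fun i => ⟨h0 i, h1 ▸ Finset.single_le_sum (fun j _ => h0 j) (Finset.mem_univ i)⟩, h1⟩

/-- A vector with coordinate sum `1` all of whose coordinates are at least `1/n` equals `g`. -/
theorem eq_gpt_of_forall_le {n : ℕ} (hn : n ≠ 0) {b : Fin n → ℝ} (h1 : ∑ i, b i = 1)
    (h : ∀ i, 1 / (n : ℝ) ≤ b i) : b = gpt n := by
  have hn' : (n : ℝ) ≠ 0 := Nat.cast_ne_zero.mpr hn
  have hs : ∑ _i : Fin n, 1 / (n : ℝ) = ∑ i, b i := by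
    rw [h1]
    simp [hn']
  funext i
  exact ((Finset.sum_eq_sum_iff_of_le fun i _ => h i).mp hs i (Finset.mem_univ i)).symm

/-- The line through `g` and a point of coordinate sum `1` has coordinate sum `1` throughout. -/
theorem sum_smul_sub_gpt_add {n : ℕ} (hn : n ≠ 0) {b : Fin n → ℝ} (h1 : ∑ i, b i = 1) (β : ℝ) :
    ∑ i, (β • (b - gpt n) + gpt n) i = 1 := by
  have hn' : (n : ℝ) ≠ 0 := Nat.cast_ne_zero.mpr hn
  simp [gpt, Finset.sum_add_distrib, ← Finset.mul_sum, h1, hn']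

/-- For `b ∈ P` with `b ≠ g`: `minᵢ bᵢ < 1/n`, and the set
`{β ≥ 0 : β·(b − g) + g ∈ K}` has greatest element `β(b) = 1/(1 − n·minᵢ bᵢ)`. -/
theorem stmt13 (n : ℕ) (hn : 2 ≤ n) (b : Fin n → ℝ) (hb : b ∈ Pset n) (hbg : b ≠ gpt n) :
    (⨅ i, b i) < 1 / (n : ℝ) ∧
    IsGreatest {β : ℝ | 0 ≤ β ∧ β • (b - gpt n) + gpt n ∈ Kset n}
      (1 / (1 - (n : ℝ) * ⨅ i, b i)) := by
  have hn0 : n ≠ 0 := by omega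
  have hnpos : (0 : ℝ) < n := Nat.cast_pos.mpr (by omega)
  have : Nonempty (Fin n) := ⟨⟨0, by omega⟩⟩
  have hsum : ∑ i, b i = 1 := by
    obtain ⟨a, -, rfl⟩ := hb
    exact sum_Psi0 hn0 a
  obtain ⟨j, hj⟩ := exists_eq_ciInf_of_finite (f := b)
  have hmin : ∀ i, b j ≤ b i := fun i => hj ▸ ciInf_le (Set.finite_range b).bddBelow i
  rw [← hj]
  have hlt : b j < 1 / (n : ℝ) := by
    by_contra! hle
    exact hbg (eq_gpt_of_forall_le hn0 hsum fun i => hle.trans (hmin i))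
  have hpos : 0 < 1 - (n : ℝ) * b j := by
    rw [lt_div_iff₀ hnpos] at hlt
    linarith
  refine ⟨hlt, ⟨by positivity, mem_Kset_of_nonneg (fun i => ?_)
    (sum_smul_sub_gpt_add hn0 hsum _)⟩, ?_⟩
  · have key : ((1 / (1 - (n : ℝ) * b j)) • (b - gpt n) + gpt n) i
        = (b i - b j) / (1 - (n : ℝ) * b j) := by
      have hne := hpos.ne'
      simp only [gpt, Pi.add_apply, Pi.smul_apply, Pi.sub_apply, smul_eq_mul]
      field_simp
      ring
    rw [key]
    exact div_nonneg (sub_nonneg.mpr (hmin i)) hpos.le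
  · rintro β ⟨-, hβ, -⟩
    have h0 := (hβ j).1
    simp only [gpt, Pi.add_apply, Pi.smul_apply, Pi.sub_apply, smul_eq_mul] at h0
    rw [le_div_iff₀ hpos]
    have h2 := mul_nonneg hnpos.le h0
    have h3 : (n : ℝ) * (β * (b j - 1 / n) + 1 / n) = 1 - β * (1 - n * b j) := by
      field_simp
      ring
    linarith
end
end

section
/- The composite map Ψ₁ = ψ ∘ (Ψ₀|_F) : F → K is bijective; moreover Ψ₁(u) = g, and for every a ∈ F whose coordinates are not all equal (equivalently a ≠ u, which is exactly the case Ψ₀(a) ≠ g), one has Ψ₁(a) = ((1 − minᵢ aᵢ)/((a₁ + ⋯ + aₙ) − n·minᵢ aᵢ))·(a − (a₁ + ⋯ + aₙ)·g) + g. -/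
noncomputable section

open scoped Classical in
/-- `ψ(b) = ((maxᵢ bᵢ − minᵢ bᵢ)/(1 − n·minᵢ bᵢ))·(b − g) + g` for `b ≠ g`, `ψ(g) = g`. -/
def psiMap (n : ℕ) (b : Fin n → ℝ) : Fin n → ℝ :=
  if b = gpt n then gpt n
  else (((⨆ i, b i) - ⨅ i, b i) / (1 - (n : ℝ) * ⨅ i, b i)) • (b - gpt n) + gpt n

theorem iInf_eq_of_forall_le {ι : Type*} {f : ι → ℝ} {j : ι} (h : ∀ i, f j ≤ f i) :
    ⨅ i, f i = f j :=
  IsLeast.csInf_eq ⟨⟨j, rfl⟩, by rintro _ ⟨i, rfl⟩; exact h i⟩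

theorem iSup_eq_of_forall_le {ι : Type*} {f : ι → ℝ} {j : ι} (h : ∀ i, f i ≤ f j) :
    ⨆ i, f i = f j :=
  IsGreatest.csSup_eq ⟨⟨j, rfl⟩, by rintro _ ⟨i, rfl⟩; exact h i⟩

theorem exists_forall_le_of_pos {n : ℕ} (hn : 0 < n) (f : Fin n → ℝ) : ∃ j, ∀ i, f j ≤ f i :=
  haveI : Nonempty (Fin n) := ⟨⟨0, hn⟩⟩
  Finite.exists_min f

theorem exists_forall_ge_of_pos {n : ℕ} (hn : 0 < n) (f : Fin n → ℝ) : ∃ j, ∀ i, f i ≤ f j :=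
  haveI : Nonempty (Fin n) := ⟨⟨0, hn⟩⟩
  Finite.exists_max f

theorem mul_min_le_sum {n : ℕ} {f : Fin n → ℝ} {j : Fin n} (h : ∀ i, f j ≤ f i) :
    (n : ℝ) * f j ≤ ∑ i, f i := by
  have := Finset.sum_le_sum (s := Finset.univ) fun i _ => h i
  simpa using this

theorem mul_min_lt_sum {n : ℕ} {f : Fin n → ℝ} {j k : Fin n} (h : ∀ i, f j ≤ f i)
    (hk : f j < f k) : (n : ℝ) * f j < ∑ i, f i := by
  have := Finset.sum_lt_sum (s := Finset.univ) (fun i _ => h i) ⟨k, Finset.mem_univ k, hk⟩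
  simpa using this

theorem Psi0_apply (n : ℕ) (a : Fin n → ℝ) (i : Fin n) :
    Psi0 n a i = a i + (1 - ∑ i, a i) / n := by
  simp [Psi0, uvec]

theorem Psi0_uvec {n : ℕ} (hn : 0 < n) : Psi0 n (uvec n) = gpt n := by
  have : (n : ℝ) ≠ 0 := by positivity
  ext i
  simp [Psi0_apply, uvec, gpt]
  field_simp
  ring

theorem eq_uvec_of_Psi0_eq_gpt {n : ℕ} {a : Fin n → ℝ} (ha : a ∈ Fset n)
    (h : Psi0 n a = gpt n) : a = uvec n := by
  obtain ⟨-, k, hk⟩ := ha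
  ext i
  have hi := congrFun h i
  have hk' := congrFun h k
  simp only [Psi0_apply, gpt] at hi hk'
  simp only [uvec]
  linarith

/-- Expansion of `Ψ₁` around the smallest coordinate; at `a = u` the quotient is `0 / 0 = 0`. -/
theorem psiMap_Psi0_apply {n : ℕ} (hn : 0 < n) {a : Fin n → ℝ} (ha : a ∈ Fset n) {j : Fin n}
    (hj : ∀ i, a j ≤ a i) (i : Fin n) :
    psiMap n (Psi0 n a) i =
      a j / n + (1 - a j) / ((∑ i, a i) - n * a j) * (a i - a j) := by
  have hn0 : (n : ℝ) ≠ 0 := by positivity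
  by_cases h : Psi0 n a = gpt n
  · obtain rfl := eq_uvec_of_Psi0_eq_gpt ha h
    simp [psiMap, h, gpt, uvec]
  · obtain ⟨hH, k, hk⟩ := ha
    have hjk : a j < a k := by
      refine lt_of_le_of_ne (hj k) fun hjk => h ?_
      have : a = uvec n := by
        ext i
        have h1 := hj i
        have h2 := (hH i).2
        simp only [uvec]
        linarith
      rw [this, Psi0_uvec hn]
    have hpos := mul_min_lt_sum hj hjk
    have hmin : ⨅ i, Psi0 n a i = Psi0 n a j :=
      iInf_eq_of_forall_le fun i => by simpa [Psi0_apply] using hj i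
    have hmax : ⨆ i, Psi0 n a i = Psi0 n a k :=
      iSup_eq_of_forall_le fun i => by simpa [Psi0_apply, hk] using (hH i).2
    have hden : 1 - (n : ℝ) * Psi0 n a j = (∑ i, a i) - n * a j := by
      rw [Psi0_apply]
      field_simp
      ring
    have hne : (∑ i, a i) - n * a j ≠ 0 := by linarith
    simp only [psiMap, h, if_false, hmin, hmax, hden, Pi.add_apply, Pi.smul_apply, Pi.sub_apply,
      smul_eq_mul]
    simp only [Psi0_apply, hk, gpt]
    field_simp
    ring

/-- The inverse of `Ψ₁`; at `k = g` the quotient is `0 / 0 = 0`. -/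
def psiInv (n : ℕ) (k : Fin n → ℝ) : Fin n → ℝ := fun i =>
  n * (⨅ i, k i) + (k i - ⨅ i, k i) / ((⨆ i, k i) - ⨅ i, k i) * (1 - n * ⨅ i, k i)

theorem mapsTo_psiMap_Psi0 {n : ℕ} (hn : 0 < n) :
    Set.MapsTo (fun a => psiMap n (Psi0 n a)) (Fset n) (Kset n) := by
  intro a ha
  have hn0 : (n : ℝ) ≠ 0 := by positivity
  obtain ⟨j, hj⟩ := exists_forall_le_of_pos hn a
  have key := psiMap_Psi0_apply hn ha hj
  have hle : 0 ≤ (∑ i, a i) - n * a j := sub_nonneg.2 (mul_min_le_sum hj)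
  have h0 : ∀ i, 0 ≤ psiMap n (Psi0 n a) i := fun i => by
    rw [key i]
    have h1 := (ha.1 j).1
    have h2 := sub_nonneg.2 (ha.1 j).2
    have h3 := sub_nonneg.2 (hj i)
    positivity
  have hsum : ∑ i, psiMap n (Psi0 n a) i = 1 := by
    simp only [key, Finset.sum_add_distrib, ← Finset.mul_sum, Finset.sum_sub_distrib,
      Finset.sum_const, Finset.card_univ, Fintype.card_fin, nsmul_eq_mul]
    obtain ⟨k, hk⟩ := ha.2
    rcases (hj k).eq_or_lt with h | h
    · rw [h, hk]
      field_simp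
      simp
    · have := mul_min_lt_sum hj h
      have hne : (∑ i, a i) - n * a j ≠ 0 := by linarith
      field_simp
      ring
  refine ⟨fun i => ⟨h0 i, ?_⟩, hsum⟩
  rw [← hsum]
  exact Finset.single_le_sum (fun i _ => h0 i) (Finset.mem_univ i)

theorem leftInvOn_psiInv {n : ℕ} (hn : 0 < n) :
    Set.LeftInvOn (psiInv n) (fun a => psiMap n (Psi0 n a)) (Fset n) := by
  intro a ha
  have hn0 : (n : ℝ) ≠ 0 := by positivity
  obtain ⟨j, hj⟩ := exists_forall_le_of_pos hn a
  have key := psiMap_Psi0_apply hn ha hj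
  obtain ⟨hH, k, hk⟩ := ha
  have hle : 0 ≤ (∑ i, a i) - n * a j := sub_nonneg.2 (mul_min_le_sum hj)
  have hr : 0 ≤ (1 - a j) / ((∑ i, a i) - n * a j) :=
    div_nonneg (sub_nonneg.2 (hH j).2) hle
  have hmin : ⨅ i, psiMap n (Psi0 n a) i = psiMap n (Psi0 n a) j :=
    iInf_eq_of_forall_le fun i => by
      simp only [key]
      gcongr
      exact hj i
  have hmax : ⨆ i, psiMap n (Psi0 n a) i = psiMap n (Psi0 n a) k :=
    iSup_eq_of_forall_le fun i => by
      simp only [key]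
      gcongr
      exact hk ▸ (hH i).2
  ext i
  simp only [psiInv, hmin, hmax]
  simp only [key, hk, sub_self, mul_zero, add_zero, add_sub_cancel_left]
  rcases (hH j).2.eq_or_lt with h | h
  · have h1 := hj i
    have h2 := (hH i).2
    have : a i = 1 := by linarith
    simp [h, this, hn0]
  · have := mul_min_lt_sum hj (h.trans_eq hk.symm)
    have hne : (∑ i, a i) - n * a j ≠ 0 := by linarith
    have hne' : 1 - a j ≠ 0 := by linarith
    field_simp
    ring

theorem uvec_mem_Fset {n : ℕ} (hn : 0 < n) : uvec n ∈ Fset n :=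
  ⟨fun i => by simp [uvec], ⟨0, hn⟩, rfl⟩

theorem surjOn_psiMap_Psi0 {n : ℕ} (hn : 0 < n) :
    Set.SurjOn (fun a => psiMap n (Psi0 n a)) (Fset n) (Kset n) := by
  rintro x ⟨hx, hsum⟩
  have hn0 : (n : ℝ) ≠ 0 := by positivity
  obtain ⟨j, hj⟩ := exists_forall_le_of_pos hn x
  obtain ⟨k, hk⟩ := exists_forall_ge_of_pos hn x
  rcases (hj k).eq_or_lt with h | h
  · refine ⟨uvec n, uvec_mem_Fset hn, ?_⟩
    have hc : ∀ i, x i = x j := fun i => le_antisymm ((hk i).trans_eq h.symm) (hj i)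
    have hs : (n : ℝ) * x j = 1 := by simpa [hc] using hsum
    ext i
    simp only [psiMap, Psi0_uvec hn, if_true, gpt, hc i]
    field_simp
    linarith
  · have hlt := mul_min_lt_sum hj h
    rw [hsum] at hlt
    have hD : 0 < x k - x j := sub_pos.2 h
    have hm : 0 < 1 - n * x j := sub_pos.2 hlt
    have hG : ∀ i, psiInv n x i = n * x j + (x i - x j) / (x k - x j) * (1 - n * x j) :=
      fun i => by simp only [psiInv, iInf_eq_of_forall_le hj, iSup_eq_of_forall_le hk]
    have hGj : psiInv n x j = n * x j := by simp [hG]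
    have hGk : psiInv n x k = 1 := by simp [hG, hD.ne']
    have hGmin : ∀ i, psiInv n x j ≤ psiInv n x i := fun i => by
      rw [hGj, hG i]
      have := sub_nonneg.2 (hj i)
      exact le_add_of_nonneg_right (by positivity)
    have hGmax : ∀ i, psiInv n x i ≤ psiInv n x k := fun i => by
      rw [hG i, hG k]
      gcongr
      exact hk i
    have hF : psiInv n x ∈ Fset n := by
      refine ⟨fun i => ⟨le_trans ?_ (hGmin i), hGk ▸ hGmax i⟩, k, hGk⟩
      rw [hGj]
      exact mul_nonneg n.cast_nonneg (hx j).1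
    have hS : (∑ i, psiInv n x i) - n * (n * x j) = (1 - n * x j) ^ 2 / (x k - x j) := by
      simp only [hG, Finset.sum_add_distrib, ← Finset.sum_mul, ← Finset.sum_div,
        Finset.sum_sub_distrib, Finset.sum_const, Finset.card_univ, Fintype.card_fin,
        nsmul_eq_mul, hsum]
      ring
    refine ⟨psiInv n x, hF, ?_⟩
    ext i
    simp only [psiMap_Psi0_apply hn hF hGmin i, hGj, hS]
    rw [hG i]
    have := hD.ne'
    have := hm.ne'
    field_simp
    ring

/-- `Ψ₁ = ψ ∘ Ψ₀|_F : F → K` is bijective; `Ψ₁(u) = g`; for `a ∈ F` the conditions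
"not all coordinates of `a` are equal", `a ≠ u` and `Ψ₀(a) ≠ g` are equivalent, and
in that case
`Ψ₁(a) = ((1 − minᵢ aᵢ)/((a₁+⋯+aₙ) − n·minᵢ aᵢ))·(a − (a₁+⋯+aₙ)·g) + g`. -/
theorem stmt15 (n : ℕ) (hn : 2 ≤ n) :
    Set.BijOn (fun a => psiMap n (Psi0 n a)) (Fset n) (Kset n) ∧
    psiMap n (Psi0 n (uvec n)) = gpt n ∧
    (∀ a ∈ Fset n, ((∃ i j, a i ≠ a j) ↔ a ≠ uvec n) ∧ (a ≠ uvec n ↔ Psi0 n a ≠ gpt n)) ∧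
    (∀ a ∈ Fset n, a ≠ uvec n →
      psiMap n (Psi0 n a)
        = ((1 - ⨅ i, a i) / ((∑ i, a i) - (n : ℝ) * ⨅ i, a i))
            • (a - (∑ i, a i) • gpt n) + gpt n) := by
  have hn' : 0 < n := by omega
  have hn0 : (n : ℝ) ≠ 0 := by positivity
  refine ⟨⟨mapsTo_psiMap_Psi0 hn', (leftInvOn_psiInv hn').injOn, surjOn_psiMap_Psi0 hn'⟩,
    by simp [psiMap, Psi0_uvec hn'], fun a ha => ⟨⟨?_, ?_⟩, ?_⟩, fun a ha hau => ?_⟩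
  · rintro ⟨i, j, hij⟩ rfl
    exact hij rfl
  · intro hau
    obtain ⟨-, k, hk⟩ := ha
    by_contra! hc
    exact hau (funext fun i => (hc i k).trans hk)
  · refine not_congr ⟨?_, eq_uvec_of_Psi0_eq_gpt ha⟩
    rintro rfl
    exact Psi0_uvec hn'
  · obtain ⟨j, hj⟩ := exists_forall_le_of_pos hn' a
    obtain ⟨i, hi⟩ := Function.ne_iff.1 hau
    obtain ⟨k, hk⟩ := ha.2
    have hjk : a j < a k :=
      (hj i).trans_lt (hk ▸ lt_of_le_of_ne (ha.1 i).2 hi)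
    have hne : (∑ i, a i) - n * a j ≠ 0 := (sub_pos.2 (mul_min_lt_sum hj hjk)).ne'
    ext i
    rw [psiMap_Psi0_apply hn' ha hj, iInf_eq_of_forall_le hj]
    simp only [gpt, Pi.add_apply, Pi.smul_apply, Pi.sub_apply, smul_eq_mul]
    generalize ∑ i, a i = S at hne ⊢
    obtain ⟨d, rfl⟩ : ∃ d, S = d + n * a j := ⟨S - n * a j, by ring⟩
    rw [add_sub_cancel_right] at hne ⊢
    field_simp
    ring
end
end

section
/- Fix a nonempty set X and an integer n ≥ 1. The map sending a fuzzy covering (C₁,…,Cₙ) of X to the family (B₁,…,Bₙ) defined by Bᵢ(x) = Cᵢ(x)/(C₁(x) + ⋯ + Cₙ(x)) is a well-defined bijection from the set of fuzzy coverings of X with index set {1,…,n} onto the set of fuzzy partitions of X with index set {1,…,n}, and its inverse sends a fuzzy partition (B₁,…,Bₙ) to the covering (C₁,…,Cₙ) with Cᵢ(x) = Bᵢ(x)/maxⱼ Bⱼ(x). -/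
noncomputable section

/-- Fuzzy coverings of `X` with index set `{1,…,n}`: families `C : Fin n → X → [0,1]`
such that every `x` has some `i` with `Cᵢ(x) = 1`. -/
def CovSet (X : Type*) (n : ℕ) : Set (Fin n → X → ℝ) :=
  {C | (∀ i x, 0 ≤ C i x ∧ C i x ≤ 1) ∧ ∀ x, ∃ i, C i x = 1}

/-- Fuzzy partitions of `X` with index set `{1,…,n}`: families `B : Fin n → X → [0,1]`
such that `B₁(x) + ⋯ + Bₙ(x) = 1` for all `x`. -/
def ParSet (X : Type*) (n : ℕ) : Set (Fin n → X → ℝ) :=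
  {B | (∀ i x, 0 ≤ B i x ∧ B i x ≤ 1) ∧ ∀ x, ∑ i, B i x = 1}

theorem one_le_sum_of_mem_covSet {X : Type*} {n : ℕ} {C : Fin n → X → ℝ}
    (hC : C ∈ CovSet X n) (x : X) : 1 ≤ ∑ j, C j x := by
  obtain ⟨i, hi⟩ := hC.2 x
  rw [← hi]
  exact Finset.single_le_sum (f := fun j => C j x) (fun j _ => (hC.1 j x).1) (Finset.mem_univ i)

theorem div_sum_mem_parSet {X : Type*} {n : ℕ} {C : Fin n → X → ℝ} (hC : C ∈ CovSet X n) :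
    (fun i x => C i x / ∑ j, C j x) ∈ ParSet X n := by
  refine ⟨fun i x => ?_, fun x => ?_⟩
  · have h := one_le_sum_of_mem_covSet hC x
    exact ⟨div_nonneg (hC.1 i x).1 (by linarith),
      div_le_one_of_le₀ ((hC.1 i x).2.trans h) (by linarith)⟩
  · have h := one_le_sum_of_mem_covSet hC x
    rw [← Finset.sum_div, div_self (by linarith)]

theorem iSup_pos_of_mem_parSet {X : Type*} {n : ℕ} {B : Fin n → X → ℝ}
    (hB : B ∈ ParSet X n) (x : X) : 0 < ⨆ j, B j x := by
  obtain ⟨i, -, hi⟩ := Finset.exists_lt_of_sum_lt (s := Finset.univ) (f := fun _ : Fin n => (0 : ℝ))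
    (g := fun j => B j x) (by simp [hB.2 x])
  exact hi.trans_le (le_ciSup (f := fun j => B j x) (Set.finite_range _).bddAbove i)

theorem div_iSup_mem_covSet {X : Type*} {n : ℕ} (hn : 1 ≤ n) {B : Fin n → X → ℝ}
    (hB : B ∈ ParSet X n) : (fun i x => B i x / ⨆ j, B j x) ∈ CovSet X n := by
  have : Nonempty (Fin n) := ⟨⟨0, hn⟩⟩
  refine ⟨fun i x => ?_, fun x => ?_⟩
  · have h := (iSup_pos_of_mem_parSet hB x).le
    exact ⟨div_nonneg (hB.1 i x).1 h, div_le_one_of_le₀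
      (le_ciSup (f := fun j => B j x) (Set.finite_range _).bddAbove i) h⟩
  · obtain ⟨i, hi⟩ := exists_eq_ciSup_of_finite (f := fun j => B j x)
    exact ⟨i, by simp only [hi, div_self (iSup_pos_of_mem_parSet hB x).ne']⟩

theorem iSup_eq_one_of_mem_covSet {X : Type*} {n : ℕ} {C : Fin n → X → ℝ}
    (hC : C ∈ CovSet X n) (x : X) : ⨆ j, C j x = 1 := by
  obtain ⟨i, hi⟩ := hC.2 x
  have : Nonempty (Fin n) := ⟨i⟩
  refine le_antisymm (ciSup_le fun j => (hC.1 j x).2) ?_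
  rw [← hi]
  exact le_ciSup (f := fun j => C j x) (Set.finite_range _).bddAbove i

theorem div_sum_div_iSup {X : Type*} {n : ℕ} {C : Fin n → X → ℝ} (hC : C ∈ CovSet X n) :
    (fun i x => (C i x / ∑ j, C j x) / ⨆ j, C j x / ∑ k, C k x) = C := by
  funext i x
  have h := one_le_sum_of_mem_covSet hC x
  have hs : ⨆ j, C j x / ∑ k, C k x = 1 / ∑ k, C k x := by
    simp only [div_eq_mul_inv]
    rw [← Real.iSup_mul_of_nonneg (inv_nonneg.2 (by linarith)), iSup_eq_one_of_mem_covSet hC x]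
  rw [hs, div_div_div_cancel_right₀ (by linarith), div_one]

theorem div_iSup_div_sum {X : Type*} {n : ℕ} {B : Fin n → X → ℝ} (hB : B ∈ ParSet X n) :
    (fun i x => (B i x / ⨆ j, B j x) / ∑ j, B j x / ⨆ k, B k x) = B := by
  funext i x
  rw [← Finset.sum_div, hB.2 x,
    div_div_div_cancel_right₀ (iSup_pos_of_mem_parSet hB x).ne', div_one]

/-- The map `(C₁,…,Cₙ) ↦ (B₁,…,Bₙ)`, `Bᵢ(x) = Cᵢ(x)/(C₁(x)+⋯+Cₙ(x))`, is a well-defined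
bijection from coverings onto partitions, with inverse `(B₁,…,Bₙ) ↦ (C₁,…,Cₙ)`,
`Cᵢ(x) = Bᵢ(x)/maxⱼ Bⱼ(x)`. -/
theorem stmt16 (X : Type*) (hX : Nonempty X) (n : ℕ) (hn : 1 ≤ n) :
    (∀ C ∈ CovSet X n, (fun i x => C i x / ∑ j, C j x) ∈ ParSet X n) ∧
    Set.BijOn (fun (C : Fin n → X → ℝ) => fun i x => C i x / ∑ j, C j x)
      (CovSet X n) (ParSet X n) ∧
    (∀ B ∈ ParSet X n, (fun i x => B i x / ⨆ j, B j x) ∈ CovSet X n) ∧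
    (∀ C ∈ CovSet X n,
      (fun i x => (C i x / ∑ j, C j x) / ⨆ j, C j x / ∑ k, C k x) = C) ∧
    (∀ B ∈ ParSet X n,
      (fun i x => (B i x / ⨆ j, B j x) / ∑ j, B j x / ⨆ k, B k x) = B) := by
  refine ⟨fun C => div_sum_mem_parSet, ?_, fun B => div_iSup_mem_covSet hn,
    fun C => div_sum_div_iSup, fun B => div_iSup_div_sum⟩
  exact Set.InvOn.bijOn (f' := fun B i x => B i x / ⨆ j, B j x)
    ⟨fun C => div_sum_div_iSup, fun B => div_iSup_div_sum⟩
    (fun C => div_sum_mem_parSet) (fun B => div_iSup_mem_covSet hn)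
end
end

section
/- The functor F : Partition → g-Covering, defined on objects by sending a fuzzy partition (X,(Bᵢ)_{i∈[n]}) to (X,(Aᵢ)_{i∈[n]}) where Aᵢ(x) = Bᵢ(x) + 1 − maxᵢ Bᵢ(x), and acting as the identity on morphisms (f,ρ), and the functor G : g-Covering → Partition, defined on objects by sending a good covering (X,(Aᵢ)_{i∈[n]}) to (X,(Bᵢ)_{i∈[n]}) where Bᵢ(x) = Aᵢ(x) − (1/n)·Σ_{j∈[n]} Aⱼ(x) + 1/n, and acting as the identity on morphisms, are well defined and fully faithful and are mutually inverse; hence the categories Partition and g-Covering are isomorphic. -/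
open CategoryTheory

/-- An object of the category `Partition`: a set `X` together with fuzzy sets
`Bᵢ : X → [0,1]`, `i ∈ [n]`, with `Σᵢ Bᵢ(x) = 1` for all `x`. -/
structure FuzzyPartition where
  X : Type
  n : ℕ
  B : Fin n → X → ℝ
  mem01 : ∀ i x, 0 ≤ B i x ∧ B i x ≤ 1
  sum_one : ∀ x, ∑ i, B i x = 1

/-- A morphism of fuzzy partitions: a pair `(f, ρ)` with
`Bᵢ(x) − maxᵢ Bᵢ(x) ≤ B'_{ρ(i)}(f(x)) − maxⱼ B'ⱼ(f(x))` for all `x`, `i`. -/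
@[ext]
structure ParHom (P Q : FuzzyPartition) where
  f : P.X → Q.X
  ρ : Fin P.n → Fin Q.n
  cond : ∀ x i, P.B i x - (⨆ j, P.B j x) ≤ Q.B (ρ i) (f x) - ⨆ j, Q.B j (f x)

instance : Category FuzzyPartition where
  Hom := ParHom
  id P := ⟨id, id, fun _ _ => le_refl _⟩
  comp φ ψ := ⟨ParHom.f ψ ∘ ParHom.f φ, ParHom.ρ ψ ∘ ParHom.ρ φ,
    fun x i => (ParHom.cond φ x i).trans (ParHom.cond ψ (ParHom.f φ x) (ParHom.ρ φ i))⟩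

/-- An object of the category `g-Covering`: a good covering, i.e. a finite fuzzy covering
`(X,(Aᵢ)_{i∈[n]})` with `Σⱼ Aⱼ(x) ≤ n·Aᵢ(x) + 1` for all `i`, `x`. -/
structure GoodCovering where
  X : Type
  n : ℕ
  A : Fin n → X → ℝ
  mem01 : ∀ i x, 0 ≤ A i x ∧ A i x ≤ 1
  cover : ∀ x, ∃ i, A i x = 1
  good : ∀ i x, ∑ j, A j x ≤ n * A i x + 1

/-- A morphism of good coverings: a pair `(f, ρ)` with `Aᵢ(x) ≤ A'_{ρ(i)}(f(x))`. -/
@[ext]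
structure GCovHom (C D : GoodCovering) where
  f : C.X → D.X
  ρ : Fin C.n → Fin D.n
  le : ∀ x i, C.A i x ≤ D.A (ρ i) (f x)

instance : Category GoodCovering where
  Hom := GCovHom
  id C := ⟨id, id, fun _ _ => le_refl _⟩
  comp φ ψ := ⟨GCovHom.f ψ ∘ GCovHom.f φ, GCovHom.ρ ψ ∘ GCovHom.ρ φ,
    fun x i => (GCovHom.le φ x i).trans (GCovHom.le ψ (GCovHom.f φ x) (GCovHom.ρ φ i))⟩

namespace FuzzyPartition

theorem le_max (P : FuzzyPartition) (i : Fin P.n) (x : P.X) : P.B i x ≤ ⨆ j, P.B j x :=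
  le_ciSup (f := fun j => P.B j x) (Set.finite_range _).bddAbove i

theorem n_pos (P : FuzzyPartition) (x : P.X) : 0 < P.n := by
  rcases Nat.eq_zero_or_pos P.n with h | h
  · have : IsEmpty (Fin P.n) := by rw [h]; infer_instance
    simpa using P.sum_one x
  · exact h

theorem exists_eq_max (P : FuzzyPartition) (x : P.X) : ∃ i, P.B i x = ⨆ j, P.B j x := by
  have : Nonempty (Fin P.n) := ⟨⟨0, P.n_pos x⟩⟩
  exact exists_eq_ciSup_of_finite (f := fun j => P.B j x)

theorem max_mem01 (P : FuzzyPartition) (x : P.X) :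
    0 ≤ (⨆ j, P.B j x) ∧ (⨆ j, P.B j x) ≤ 1 := by
  obtain ⟨i, hi⟩ := P.exists_eq_max x
  exact hi ▸ P.mem01 i x

theorem sum_shift (P : FuzzyPartition) (x : P.X) :
    ∑ i, (P.B i x + 1 - ⨆ j, P.B j x) = 1 + P.n - P.n * ⨆ j, P.B j x := by
  simp [Finset.sum_sub_distrib, Finset.sum_add_distrib, P.sum_one x]

/-- The good covering `Aᵢ(x) = Bᵢ(x) + 1 − maxⱼ Bⱼ(x)` of a fuzzy partition. -/
noncomputable def toGoodCovering (P : FuzzyPartition) : GoodCovering where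
  X := P.X
  n := P.n
  A i x := P.B i x + 1 - ⨆ j, P.B j x
  mem01 i x := by
    have h₁ := P.mem01 i x
    have h₂ := P.max_mem01 x
    have h₃ := P.le_max i x
    constructor <;> linarith
  cover x := (P.exists_eq_max x).imp fun i hi => by rw [hi]; ring
  good i x := by
    rw [P.sum_shift x]
    have := mul_nonneg (Nat.cast_nonneg (α := ℝ) P.n) (P.mem01 i x).1
    linarith

end FuzzyPartition

namespace GoodCovering

theorem n_pos (C : GoodCovering) (x : C.X) : 0 < C.n :=
  let ⟨i, _⟩ := C.cover x
  i.pos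

theorem one_le_sum (C : GoodCovering) (x : C.X) : 1 ≤ ∑ j, C.A j x := by
  obtain ⟨i, hi⟩ := C.cover x
  exact hi ▸ Finset.single_le_sum (f := fun j => C.A j x)
    (fun j _ => (C.mem01 j x).1) (Finset.mem_univ i)

/-- The fuzzy partition `Bᵢ(x) = Aᵢ(x) − (1/n)·Σⱼ Aⱼ(x) + 1/n` of a good covering. -/
noncomputable def toFuzzyPartition (C : GoodCovering) : FuzzyPartition where
  X := C.X
  n := C.n
  B i x := C.A i x - (1 / (C.n : ℝ)) * ∑ j, C.A j x + 1 / (C.n : ℝ)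
  mem01 i x := by
    have hn : (0 : ℝ) < C.n := Nat.cast_pos.2 (C.n_pos x)
    have h₁ := C.one_le_sum x
    have h₂ := C.good i x
    have h₃ := (C.mem01 i x).2
    have h₄ : C.A i x - (1 / (C.n : ℝ)) * ∑ j, C.A j x + 1 / (C.n : ℝ) =
        C.A i x - (∑ j, C.A j x - 1) / C.n := by ring
    rw [h₄]
    constructor
    · rw [sub_nonneg, div_le_iff₀ hn]
      linarith
    · have : 0 ≤ (∑ j, C.A j x - 1) / C.n := div_nonneg (by linarith) hn.le
      linarith
  sum_one x := by
    have hn : (C.n : ℝ) ≠ 0 := Nat.cast_ne_zero.2 (C.n_pos x).ne'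
    simp only [Finset.sum_add_distrib, Finset.sum_sub_distrib, Finset.sum_const,
      Finset.card_univ, Fintype.card_fin, nsmul_eq_mul]
    field_simp
    ring

theorem max_toFuzzyPartition (C : GoodCovering) (x : C.X) :
    (⨆ j, C.toFuzzyPartition.B j x) =
      1 - (1 / (C.n : ℝ)) * ∑ j, C.A j x + 1 / (C.n : ℝ) := by
  obtain ⟨i, hi⟩ := C.cover x
  have : Nonempty (Fin C.toFuzzyPartition.n) := ⟨i⟩
  refine le_antisymm (ciSup_le fun j => ?_) ?_
  · have := (C.mem01 j x).2
    simp only [toFuzzyPartition]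
    linarith
  · have := C.toFuzzyPartition.le_max i x
    rwa [show C.toFuzzyPartition.B i x = 1 - (1 / (C.n : ℝ)) * ∑ j, C.A j x + 1 / (C.n : ℝ) by
      simp only [toFuzzyPartition, hi]] at this

theorem toFuzzyPartition_sub_max (C : GoodCovering) (i : Fin C.n) (x : C.X) :
    C.toFuzzyPartition.B i x - (⨆ j, C.toFuzzyPartition.B j x) = C.A i x - 1 := by
  rw [C.max_toFuzzyPartition x]
  simp only [toFuzzyPartition]
  ring

theorem toGoodCovering_toFuzzyPartition (C : GoodCovering) :
    C.toFuzzyPartition.toGoodCovering = C := by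
  have h : C.toFuzzyPartition.toGoodCovering.A = C.A := by
    funext i x
    have := C.toFuzzyPartition_sub_max i x
    change C.toFuzzyPartition.B i x + 1 - (⨆ j, C.toFuzzyPartition.B j x) = C.A i x
    linarith
  cases C
  exact (GoodCovering.mk.injEq ..).mpr ⟨rfl, rfl, heq_of_eq h⟩

end GoodCovering

theorem FuzzyPartition.toFuzzyPartition_toGoodCovering (P : FuzzyPartition) :
    P.toGoodCovering.toFuzzyPartition = P := by
  have h : P.toGoodCovering.toFuzzyPartition.B = P.B := by
    funext i x
    have hn : (P.n : ℝ) ≠ 0 := Nat.cast_ne_zero.2 (P.n_pos x).ne'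
    change P.B i x + 1 - (⨆ j, P.B j x) -
      (1 / (P.n : ℝ)) * ∑ i, (P.B i x + 1 - ⨆ j, P.B j x) + 1 / (P.n : ℝ) = P.B i x
    rw [P.sum_shift x]
    field_simp
    ring
  cases P
  exact (FuzzyPartition.mk.injEq ..).mpr ⟨rfl, rfl, heq_of_eq h⟩

theorem ParHom.hext {P P' Q Q' : FuzzyPartition} (hP : P = P') (hQ : Q = Q')
    {φ : ParHom P Q} {ψ : ParHom P' Q'} (hf : HEq φ.f ψ.f) (hρ : HEq φ.ρ ψ.ρ) : HEq φ ψ := by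
  subst hP hQ
  exact heq_of_eq (ParHom.ext (eq_of_heq hf) (eq_of_heq hρ))

theorem GCovHom.hext {C C' D D' : GoodCovering} (hC : C = C') (hD : D = D')
    {φ : GCovHom C D} {ψ : GCovHom C' D'} (hf : HEq φ.f ψ.f) (hρ : HEq φ.ρ ψ.ρ) : HEq φ ψ := by
  subst hC hD
  exact heq_of_eq (GCovHom.ext (eq_of_heq hf) (eq_of_heq hρ))

/-- The functor from fuzzy partitions to good coverings, the identity on morphisms. -/
noncomputable def partitionToCovering : FuzzyPartition ⥤ GoodCovering where
  obj P := P.toGoodCovering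
  map {P Q} φ := ({
    f := ParHom.f φ
    ρ := ParHom.ρ φ
    le := fun x i => by
      have := ParHom.cond φ x i
      simp only [FuzzyPartition.toGoodCovering]
      linarith } : GCovHom P.toGoodCovering Q.toGoodCovering)
  map_id _ := rfl
  map_comp _ _ := rfl

/-- The functor from good coverings to fuzzy partitions, the identity on morphisms. -/
noncomputable def coveringToPartition : GoodCovering ⥤ FuzzyPartition where
  obj C := C.toFuzzyPartition
  map {C D} φ := ({
    f := GCovHom.f φ
    ρ := GCovHom.ρ φ
    cond := fun x i => by
      have := GCovHom.le φ x i
      have h₁ := C.toFuzzyPartition_sub_max i x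
      have h₂ := D.toFuzzyPartition_sub_max (GCovHom.ρ φ i) (GCovHom.f φ x)
      exact h₁.trans_le ((sub_le_sub_right this 1).trans_eq h₂.symm) } :
    ParHom C.toFuzzyPartition D.toFuzzyPartition)
  map_id _ := rfl
  map_comp _ _ := rfl

theorem partitionToCovering_full : partitionToCovering.Full where
  map_surjective {P Q} φ := by
    refine ⟨(⟨GCovHom.f φ, GCovHom.ρ φ, fun x i => ?_⟩ : ParHom P Q), rfl⟩
    have h : P.B i x + 1 - (⨆ j, P.B j x) ≤
        Q.B (GCovHom.ρ φ i) (GCovHom.f φ x) + 1 - ⨆ j, Q.B j (GCovHom.f φ x) :=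
      GCovHom.le φ x i
    linarith

theorem partitionToCovering_faithful : partitionToCovering.Faithful where
  map_injective h := ParHom.ext (congrArg GCovHom.f h) (congrArg GCovHom.ρ h)

theorem coveringToPartition_full : coveringToPartition.Full where
  map_surjective {C D} φ := by
    refine ⟨(⟨ParHom.f φ, ParHom.ρ φ, fun x i => ?_⟩ : GCovHom C D), rfl⟩
    have h := ParHom.cond φ x i
    have h₁ := C.toFuzzyPartition_sub_max i x
    have h₂ := D.toFuzzyPartition_sub_max (ParHom.ρ φ i) (ParHom.f φ x)
    exact sub_le_sub_iff_right 1 |>.1 (h₁.symm.trans_le (h.trans_eq h₂))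

theorem coveringToPartition_faithful : coveringToPartition.Faithful where
  map_injective h := GCovHom.ext (congrArg ParHom.f h) (congrArg ParHom.ρ h)

theorem partitionToCovering_comp_coveringToPartition :
    partitionToCovering ⋙ coveringToPartition = 𝟭 FuzzyPartition :=
  Functor.hext FuzzyPartition.toFuzzyPartition_toGoodCovering fun P Q _ =>
    ParHom.hext P.toFuzzyPartition_toGoodCovering Q.toFuzzyPartition_toGoodCovering
      HEq.rfl HEq.rfl

theorem coveringToPartition_comp_partitionToCovering :
    coveringToPartition ⋙ partitionToCovering = 𝟭 GoodCovering :=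
  Functor.hext GoodCovering.toGoodCovering_toFuzzyPartition fun C D _ =>
    GCovHom.hext C.toGoodCovering_toFuzzyPartition D.toGoodCovering_toFuzzyPartition
      HEq.rfl HEq.rfl

/-- The functors `F : Partition ⥤ g-Covering` (with `Aᵢ(x) = Bᵢ(x) + 1 − maxⱼ Bⱼ(x)`,
identity on morphisms) and `G : g-Covering ⥤ Partition` (with
`Bᵢ(x) = Aᵢ(x) − (1/n)·Σⱼ Aⱼ(x) + 1/n`, identity on morphisms) are well defined, fully
faithful, and mutually inverse; hence `Partition` and `g-Covering` are isomorphic. -/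
theorem stmt18 :
    ∃ (F : FuzzyPartition ⥤ GoodCovering) (G : GoodCovering ⥤ FuzzyPartition),
      (∀ P : FuzzyPartition, (F.obj P).X = P.X ∧ (F.obj P).n = P.n ∧
        HEq (F.obj P).A (fun (i : Fin P.n) (x : P.X) => P.B i x + 1 - ⨆ j, P.B j x)) ∧
      (∀ (P Q : FuzzyPartition) (φ : P ⟶ Q),
        HEq (GCovHom.f (F.map φ)) (ParHom.f φ) ∧ HEq (GCovHom.ρ (F.map φ)) (ParHom.ρ φ)) ∧
      (∀ C : GoodCovering, (G.obj C).X = C.X ∧ (G.obj C).n = C.n ∧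
        HEq (G.obj C).B (fun (i : Fin C.n) (x : C.X) =>
          C.A i x - (1 / (C.n : ℝ)) * ∑ j, C.A j x + 1 / (C.n : ℝ))) ∧
      (∀ (C D : GoodCovering) (φ : C ⟶ D),
        HEq (ParHom.f (G.map φ)) (GCovHom.f φ) ∧ HEq (ParHom.ρ (G.map φ)) (GCovHom.ρ φ)) ∧
      F.Full ∧ F.Faithful ∧ G.Full ∧ G.Faithful ∧
      F ⋙ G = 𝟭 FuzzyPartition ∧ G ⋙ F = 𝟭 GoodCovering := by
  exact ⟨partitionToCovering, coveringToPartition,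
    fun _ => ⟨rfl, rfl, HEq.rfl⟩, fun _ _ _ => ⟨HEq.rfl, HEq.rfl⟩,
    fun _ => ⟨rfl, rfl, HEq.rfl⟩, fun _ _ _ => ⟨HEq.rfl, HEq.rfl⟩,
    partitionToCovering_full, partitionToCovering_faithful,
    coveringToPartition_full, coveringToPartition_faithful,
    partitionToCovering_comp_coveringToPartition,
    coveringToPartition_comp_partitionToCovering⟩
end
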